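/- arXiv:2504.10653 — 5 statements merged into one kernel-verified Lean document; each statement's English description precedes it below -/
import Mathlib

section
/- Let μ0 = N(0, I_d) be the standard Gaussian on ℝ^d and let μ1(x) = e^{-V_1(x)} be a κ-log-concave probability density with V_1 ∈ C²(ℝ^d) and κ ≥ 0. Let (μ_t) be the isotropic stochastic interpolant with coefficients (α_t), (β_t) and velocity field v_t. Then for each t ∈ (0,1) the velocity field is conservative: v_t(x) = ∇φ_t(x) where φ_t(x) = (α̇_t/(2α_t))‖x‖² + (β̇_t − α̇_t β_t/α_t)(α_t²/β_t) b_t(x), and t ↦ φ_t belongs to C¹((0,1), C¹(ℝ^d)). -/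
open MeasureTheory Real Set
open scoped RealInnerProductSpace

noncomputable section

abbrev Euc (d : ℕ) := EuclideanSpace ℝ (Fin d)

/-- The cumulant generating function `b_t(x)` of the conditional density of `X₁` given
`X_t = x` for the isotropic stochastic interpolant with Gaussian base. -/
def cgf {d : ℕ} (V₁ : Euc d → ℝ) (α β : ℝ → ℝ) (t : ℝ) (x : Euc d) : ℝ :=
  Real.log (∫ y : Euc d,
    Real.exp (-V₁ y - (β t) ^ 2 / (2 * (α t) ^ 2) * ‖y‖ ^ 2 + (β t) / (α t) ^ 2 * ⟪y, x⟫))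

/-- The potential `φ_t(x)`. -/
def phiSI {d : ℕ} (V₁ : Euc d → ℝ) (α β : ℝ → ℝ) (t : ℝ) (x : Euc d) : ℝ :=
  deriv α t / (2 * α t) * ‖x‖ ^ 2 +
    (deriv β t - deriv α t * β t / α t) * ((α t) ^ 2 / β t) * cgf V₁ α β t x

/-- The functional `(s, z) ↦ ⟪y, z⟫ - s ‖y‖²` of the parameters of a Gaussian-type tilt. -/
def tiltCLM {d : ℕ} (y : Euc d) : ℝ × Euc d →L[ℝ] ℝ :=
  (innerSL ℝ y).comp (ContinuousLinearMap.snd ℝ ℝ (Euc d)) -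
    ‖y‖ ^ 2 • ContinuousLinearMap.fst ℝ ℝ (Euc d)

lemma tiltCLM_apply {d : ℕ} (y : Euc d) (p : ℝ × Euc d) :
    tiltCLM y p = ⟪y, p.2⟫ - ‖y‖ ^ 2 * p.1 := by
  simp [tiltCLM]

lemma continuous_tiltCLM {d : ℕ} : Continuous (tiltCLM : Euc d → _) := by
  unfold tiltCLM
  exact ((innerSL ℝ).continuous.clm_comp continuous_const).sub
    ((continuous_norm.pow 2).smul continuous_const)

lemma norm_tiltCLM_le {d : ℕ} (y : Euc d) : ‖tiltCLM y‖ ≤ ‖y‖ + ‖y‖ ^ 2 := by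
  refine ContinuousLinearMap.opNorm_le_bound _ (by positivity) fun p => ?_
  rw [tiltCLM_apply]
  have h1 : ‖⟪y, p.2⟫‖ ≤ ‖y‖ * ‖p‖ :=
    (norm_inner_le_norm y p.2).trans (by gcongr; exact norm_snd_le p)
  have h2 : ‖‖y‖ ^ 2 * p.1‖ ≤ ‖y‖ ^ 2 * ‖p‖ := by
    rw [norm_mul, norm_pow, norm_norm]
    gcongr
    exact norm_fst_le p
  calc _ ≤ _ := norm_sub_le _ _
    _ ≤ _ := by linarith

/-- The unnormalized tilted density `exp (-V y + ⟪y, z⟫ - s ‖y‖²)`. -/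
def tiltDensity {d : ℕ} (V : Euc d → ℝ) (p : ℝ × Euc d) (y : Euc d) : ℝ :=
  Real.exp (-V y + tiltCLM y p)

/-- The partition function of `tiltDensity`. -/
def tiltPartition {d : ℕ} (V : Euc d → ℝ) (p : ℝ × Euc d) : ℝ :=
  ∫ y, tiltDensity V p y

lemma continuous_tiltDensity {d : ℕ} {V : Euc d → ℝ} (hV : Continuous V) (p : ℝ × Euc d) :
    Continuous (tiltDensity V p) :=
  Real.continuous_exp.comp
    (hV.neg.add (continuous_tiltCLM.clm_apply continuous_const))

/-- Near a parameter with `s > 0`, the tilted density multiplied by a quadratic polynomial in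
`‖y‖` is uniformly dominated by a multiple of `exp (-V)`. -/
lemma exists_tiltDensity_bound {d : ℕ} (V : Euc d → ℝ) {p₀ : ℝ × Euc d} (hp₀ : 0 < p₀.1) :
    ∃ ε > 0, ∃ C, ∀ p ∈ Metric.ball p₀ ε, ∀ y,
      tiltDensity V p y * (1 + ‖y‖ + ‖y‖ ^ 2) ≤ C * Real.exp (-V y) := by
  set a := p₀.1 / 2 with ha
  set R := ‖p₀‖ + a + 1 with hR
  have hapos : 0 < a := by positivity
  refine ⟨a, hapos, 2 * Real.exp (R ^ 2 / (4 * a)), fun p hp y => ?_⟩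
  rw [mem_ball_iff_norm] at hp
  have hs : a ≤ p.1 := by
    have h := (norm_fst_le (p - p₀)).trans_lt hp
    rw [Prod.fst_sub, Real.norm_eq_abs, abs_lt] at h
    linarith [h.1]
  have hz : ‖p.2‖ ≤ R - 1 := by
    have h := norm_le_norm_add_norm_sub' p p₀
    linarith [norm_snd_le p]
  have hinner : ⟪y, p.2⟫ ≤ ‖y‖ * (R - 1) :=
    (real_inner_le_norm y p.2).trans (by gcongr)
  have hsq : ‖y‖ ^ 2 * a ≤ ‖y‖ ^ 2 * p.1 := by gcongr
  have hpoly : 1 + ‖y‖ + ‖y‖ ^ 2 ≤ 2 * Real.exp ‖y‖ := by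
    have := Real.quadratic_le_exp_of_nonneg (norm_nonneg y)
    nlinarith [norm_nonneg y]
  have hexp : R * ‖y‖ - ‖y‖ ^ 2 * a ≤ R ^ 2 / (4 * a) := by
    rw [le_div_iff₀ (by positivity)]
    nlinarith [sq_nonneg (2 * a * ‖y‖ - R)]
  have htilt : tiltCLM y p + ‖y‖ ≤ R ^ 2 / (4 * a) := by
    rw [tiltCLM_apply]
    linarith
  calc tiltDensity V p y * (1 + ‖y‖ + ‖y‖ ^ 2)
      ≤ Real.exp (-V y + tiltCLM y p) * (2 * Real.exp ‖y‖) := by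
        unfold tiltDensity
        gcongr
    _ = 2 * Real.exp (tiltCLM y p + ‖y‖) * Real.exp (-V y) := by
        simp only [Real.exp_add]
        ring
    _ ≤ _ := by gcongr

lemma tiltDensity_pos {d : ℕ} (V : Euc d → ℝ) (p : ℝ × Euc d) (y : Euc d) :
    0 < tiltDensity V p y :=
  Real.exp_pos _

lemma norm_tiltDensity_smul_le {d : ℕ} {F : Type*} [NormedAddCommGroup F] [NormedSpace ℝ F]
    {V : Euc d → ℝ} {p : ℝ × Euc d} {y : Euc d} {B : ℝ}
    (hB : tiltDensity V p y * (1 + ‖y‖ + ‖y‖ ^ 2) ≤ B)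
    {w : F} (hw : ‖w‖ ≤ 1 + ‖y‖ + ‖y‖ ^ 2) : ‖tiltDensity V p y • w‖ ≤ B := by
  have h := tiltDensity_pos V p y
  rw [norm_smul, Real.norm_of_nonneg h.le]
  exact (by gcongr : _ ≤ tiltDensity V p y * (1 + ‖y‖ + ‖y‖ ^ 2)).trans hB

lemma integrable_tiltDensity_smul {d : ℕ} {F : Type*} [NormedAddCommGroup F] [NormedSpace ℝ F]
    {V : Euc d → ℝ} (hV : Continuous V) (hint : Integrable fun y => Real.exp (-V y))
    {p : ℝ × Euc d} (hp : 0 < p.1) {g : Euc d → F}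
    (hg : AEStronglyMeasurable g) (hgb : ∀ y, ‖g y‖ ≤ 1 + ‖y‖ + ‖y‖ ^ 2) :
    Integrable fun y => tiltDensity V p y • g y := by
  obtain ⟨ε, hε, C, hC⟩ := exists_tiltDensity_bound V hp
  exact (hint.const_mul C).mono'
    ((continuous_tiltDensity hV p).aestronglyMeasurable.smul hg)
    (.of_forall fun y =>
      norm_tiltDensity_smul_le (hC p (Metric.mem_ball_self hε) y) (hgb y))

lemma integrable_tiltDensity {d : ℕ} {V : Euc d → ℝ} (hV : Continuous V)
    (hint : Integrable fun y => Real.exp (-V y)) {p : ℝ × Euc d} (hp : 0 < p.1) :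
    Integrable (tiltDensity V p) := by
  simpa using integrable_tiltDensity_smul hV hint hp (g := fun _ => (1 : ℝ))
    aestronglyMeasurable_const (fun y => by rw [norm_one]; nlinarith [norm_nonneg y])

lemma norm_tiltCLM_le_one_add {d : ℕ} (y : Euc d) : ‖tiltCLM y‖ ≤ 1 + ‖y‖ + ‖y‖ ^ 2 := by
  linarith [norm_tiltCLM_le y]

lemma hasFDerivAt_tiltDensity {d : ℕ} (V : Euc d → ℝ) (p : ℝ × Euc d) (y : Euc d) :
    HasFDerivAt (fun q => tiltDensity V q y) (tiltDensity V p y • tiltCLM y) p :=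
  ((tiltCLM y).hasFDerivAt.const_add (-V y)).exp

lemma hasFDerivAt_tiltPartition {d : ℕ} {V : Euc d → ℝ} (hV : Continuous V)
    (hint : Integrable fun y => Real.exp (-V y)) {p : ℝ × Euc d} (hp : 0 < p.1) :
    HasFDerivAt (tiltPartition V) (∫ y, tiltDensity V p y • tiltCLM y) p := by
  obtain ⟨ε, hε, C, hC⟩ := exists_tiltDensity_bound V hp
  exact hasFDerivAt_integral_of_dominated_of_fderiv_le (Metric.ball_mem_nhds p hε)
    (.of_forall fun q => (continuous_tiltDensity hV q).aestronglyMeasurable)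
    (integrable_tiltDensity hV hint hp)
    ((continuous_tiltDensity hV p).smul continuous_tiltCLM).aestronglyMeasurable
    (.of_forall fun y q hq => norm_tiltDensity_smul_le (hC q hq y) (norm_tiltCLM_le_one_add y))
    (hint.const_mul C)
    (.of_forall fun y q _ => hasFDerivAt_tiltDensity V q y)

lemma contDiffAt_tiltPartition {d : ℕ} {V : Euc d → ℝ} (hV : Continuous V)
    (hint : Integrable fun y => Real.exp (-V y)) {p : ℝ × Euc d} (hp : 0 < p.1) :
    ContDiffAt ℝ 1 (tiltPartition V) p := by
  rw [contDiffAt_one_iff]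
  refine ⟨fun q => ∫ y, tiltDensity V q y • tiltCLM y, {q | 0 < q.1},
    (isOpen_lt continuous_const continuous_fst).mem_nhds hp, fun q hq => ?_,
    fun q hq => hasFDerivAt_tiltPartition hV hint hq⟩
  obtain ⟨ε, hε, C, hC⟩ := exists_tiltDensity_bound V hq
  refine ContinuousAt.continuousWithinAt
    (continuousAt_of_dominated (bound := fun y => C * Real.exp (-V y))
      (.of_forall fun r =>
        ((continuous_tiltDensity hV r).smul continuous_tiltCLM).aestronglyMeasurable)
      ?_ (hint.const_mul C)
      (.of_forall fun y => (hasFDerivAt_tiltDensity V q y).continuousAt.smul continuousAt_const))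
  filter_upwards [Metric.ball_mem_nhds q hε] with r hr
  exact .of_forall fun y => norm_tiltDensity_smul_le (hC r hr y) (norm_tiltCLM_le_one_add y)

lemma tiltPartition_pos {d : ℕ} {V : Euc d → ℝ} (hV : Continuous V)
    (hint : Integrable fun y => Real.exp (-V y)) {p : ℝ × Euc d} (hp : 0 < p.1) :
    0 < tiltPartition V p :=
  integral_exp_pos (integrable_tiltDensity hV hint hp)

lemma integrable_tiltDensity_smul_id {d : ℕ} {V : Euc d → ℝ} (hV : Continuous V)
    (hint : Integrable fun y => Real.exp (-V y)) {p : ℝ × Euc d} (hp : 0 < p.1) :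
    Integrable fun y => tiltDensity V p y • y :=
  integrable_tiltDensity_smul hV hint hp aestronglyMeasurable_id
    fun y => by nlinarith [norm_nonneg y]

/-- The mean of the normalized tilted density. -/
def tiltMean {d : ℕ} (V : Euc d → ℝ) (p : ℝ × Euc d) : Euc d :=
  (tiltPartition V p)⁻¹ • ∫ y, tiltDensity V p y • y

lemma hasGradientAt_log_tiltPartition {d : ℕ} {V : Euc d → ℝ} (hV : Continuous V)
    (hint : Integrable fun y => Real.exp (-V y)) {s : ℝ} (hs : 0 < s) (c : ℝ) (x : Euc d) :
    HasGradientAt (fun x => Real.log (tiltPartition V (s, c • x)))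
      (c • tiltMean V (s, c • x)) x := by
  have hp : 0 < ((s, c • x) : ℝ × Euc d).1 := hs
  have hinner : HasFDerivAt (fun x : Euc d => ((s, c • x) : ℝ × Euc d))
      ((0 : Euc d →L[ℝ] ℝ).prod (c • ContinuousLinearMap.id ℝ (Euc d))) x :=
    (hasFDerivAt_const s x).prodMk ((hasFDerivAt_id x).const_smul c)
  have hcomp : HasFDerivAt (fun x => tiltPartition V (s, c • x)) _ x :=
    HasFDerivAt.comp (g := tiltPartition V) x (hasFDerivAt_tiltPartition hV hint hp) hinner
  have h := hcomp.log (tiltPartition_pos hV hint hp).ne'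
  rw [hasGradientAt_iff_hasFDerivAt]
  refine h.congr_fderiv (ContinuousLinearMap.ext fun w => ?_)
  have hL := ContinuousLinearMap.integral_apply
    (integrable_tiltDensity_smul hV hint hp continuous_tiltCLM.aestronglyMeasurable
      norm_tiltCLM_le_one_add) ((0, c • w) : ℝ × Euc d)
  have hI := integral_inner (𝕜 := ℝ) (integrable_tiltDensity_smul_id hV hint hp) w
  simp only [smul_apply, tiltCLM_apply, mul_zero, sub_zero, smul_eq_mul,
    inner_smul_right] at hL hI
  simp only [smul_apply, ContinuousLinearMap.comp_apply,
    ContinuousLinearMap.prod_apply, ContinuousLinearMap.zero_apply, ContinuousLinearMap.id_apply,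
    smul_eq_mul, InnerProductSpace.toDual_apply_apply, tiltMean, inner_smul_left,
    RCLike.conj_to_real, hL]
  rw [real_inner_comm, ← hI, ← integral_const_mul, ← integral_const_mul, ← integral_const_mul]
  refine integral_congr_ae (.of_forall fun y => ?_)
  simp only [real_inner_comm w y]
  ring

lemma cgf_eq_log_tiltPartition {d : ℕ} (V : Euc d → ℝ) (α β : ℝ → ℝ) (t : ℝ) (x : Euc d) :
    cgf V α β t x =
      Real.log (tiltPartition V (β t ^ 2 / (2 * α t ^ 2), (β t / α t ^ 2) • x)) := by
  unfold cgf tiltPartition tiltDensity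
  congr 2 with y
  rw [tiltCLM_apply, inner_smul_right]
  ring_nf

lemma exp_posterior_eq {d : ℕ} (V : Euc d → ℝ) {a b : ℝ} (ha : a ≠ 0) (x y : Euc d) :
    Real.exp (-V y - ‖x - b • y‖ ^ 2 / (2 * a ^ 2)) =
      Real.exp (-‖x‖ ^ 2 / (2 * a ^ 2)) *
        tiltDensity V (b ^ 2 / (2 * a ^ 2), (b / a ^ 2) • x) y := by
  unfold tiltDensity
  rw [← Real.exp_add, tiltCLM_apply, norm_sub_sq_real, inner_smul_right, inner_smul_right,
    norm_smul, mul_pow, Real.norm_eq_abs, sq_abs, real_inner_comm]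
  congr 1
  field_simp
  ring

/-- The posterior expectation of an affine velocity in terms of the mean of the tilted density. -/
lemma posterior_expectation_eq {d : ℕ} {V : Euc d → ℝ} (hV : Continuous V)
    (hint : Integrable fun y => Real.exp (-V y)) {a b : ℝ} (ha : 0 < a) (hb : 0 < b)
    (k l : ℝ) (x : Euc d) :
    (∫ y : Euc d, Real.exp (-V y - ‖x - b • y‖ ^ 2 / (2 * a ^ 2)))⁻¹ •
        ∫ y : Euc d, Real.exp (-V y - ‖x - b • y‖ ^ 2 / (2 * a ^ 2)) •
          (k • (x - b • y) + l • y) =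
      k • x + (l - k * b) • tiltMean V (b ^ 2 / (2 * a ^ 2), (b / a ^ 2) • x) := by
  set p : ℝ × Euc d := (b ^ 2 / (2 * a ^ 2), (b / a ^ 2) • x) with hp_def
  have hp : 0 < p.1 := by simp only [hp_def]; positivity
  have hZ := (tiltPartition_pos hV hint hp).ne'
  simp only [exp_posterior_eq V ha.ne', ← hp_def, mul_smul]
  rw [integral_const_mul, integral_smul, mul_inv, smul_smul, mul_right_comm,
    inv_mul_cancel₀ (Real.exp_pos _).ne', one_mul]
  have hsplit : ∀ y, tiltDensity V p y • (k • (x - b • y) + l • y) =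
      tiltDensity V p y • (k • x) + (l - k * b) • tiltDensity V p y • y := fun y => by
    module
  simp only [hsplit]
  have hI := (integrable_tiltDensity_smul_id hV hint hp).fun_smul (l - k * b)
  rw [integral_add ((integrable_tiltDensity hV hint hp).smul_const _) hI,
    integral_smul_const, integral_smul,
    show ∫ y, tiltDensity V p y = tiltPartition V p from rfl, smul_add,
    inv_smul_smul₀ hZ, smul_comm, tiltMean]

/-- With a standard Gaussian base `μ₀ = N(0, I_d)` and a `κ`-log-concave
target density `μ₁ = e^{-V₁}`, the velocity field of the isotropic stochastic interpolant
(given by conditional expectation, here realized by its regular conditional density) is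
conservative: `v_t = ∇φ_t` on `(0,1)`, and `(t, x) ↦ φ_t(x)` is `C¹` on `(0,1) × ℝ^d`. -/
theorem stochastic_interpolant_velocity_conservative
    (d : ℕ) (κ : ℝ) (hκ : 0 ≤ κ)
    (V₁ : Euc d → ℝ) (hV₁ : ContDiff ℝ 2 V₁)
    (hμ₁ : (∫ y : Euc d, Real.exp (-V₁ y)) = 1)
    (hlc : ∀ x w : Euc d, κ * ‖w‖ ^ 2 ≤ iteratedFDeriv ℝ 2 V₁ x ![w, w])
    (α β : ℝ → ℝ) (hα : ContDiff ℝ 2 α) (hβ : ContDiff ℝ 2 β)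
    (hα0 : α 0 = 1) (hα1 : α 1 = 0) (hβ0 : β 0 = 0) (hβ1 : β 1 = 1)
    (hαpos : ∀ t ∈ Ioo (0:ℝ) 1, 0 < α t) (hβpos : ∀ t ∈ Ioo (0:ℝ) 1, 0 < β t)
    (v : ℝ → Euc d → Euc d)
    -- `v t x = E[α̇_t X₀ + β̇_t X₁ | α_t X₀ + β_t X₁ = x]`, written via the regular
    -- conditional density of `X₁` given `X_t = x` (where `X₀ = (x - β_t X₁)/α_t`):
    (hv : ∀ t ∈ Ioo (0:ℝ) 1, ∀ x : Euc d, v t x =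
      (∫ y : Euc d, Real.exp (-V₁ y - ‖x - β t • y‖ ^ 2 / (2 * (α t) ^ 2)))⁻¹ •
        ∫ y : Euc d, Real.exp (-V₁ y - ‖x - β t • y‖ ^ 2 / (2 * (α t) ^ 2)) •
          ((deriv α t / α t) • (x - β t • y) + deriv β t • y)) :
    (∀ t ∈ Ioo (0:ℝ) 1, ∀ x : Euc d, v t x = gradient (phiSI V₁ α β t) x) ∧
      ContDiffOn ℝ 1 (fun p : ℝ × Euc d => phiSI V₁ α β p.1 p.2)
        (Ioo (0:ℝ) 1 ×ˢ (univ : Set (Euc d))) := by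
  have hV : Continuous V₁ := hV₁.continuous
  have hint : Integrable fun y => Real.exp (-V₁ y) :=
    .of_integral_ne_zero (by rw [hμ₁]; exact one_ne_zero)
  refine ⟨fun t ht x => ?_, fun p hp => ContDiffAt.contDiffWithinAt ?_⟩
  · have ha := hαpos t ht
    have hb := hβpos t ht
    have hs : 0 < β t ^ 2 / (2 * α t ^ 2) := by positivity
    have hsq : HasGradientAt (fun x : Euc d => ‖x‖ ^ 2) ((2 : ℝ) • x) x := by
      rw [hasGradientAt_iff_hasFDerivAt]
      refine (hasStrictFDerivAt_norm_sq x).hasFDerivAt.congr_fderiv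
        (ContinuousLinearMap.ext fun w => ?_)
      simp
    have hlog := hasGradientAt_log_tiltPartition hV hint hs (β t / α t ^ 2) x
    have hgrad := (hsq.hasFDerivAt.const_mul (deriv α t / (2 * α t))).add
      (hlog.hasFDerivAt.const_mul
        ((deriv β t - deriv α t * β t / α t) * ((α t) ^ 2 / β t)))
    rw [hv t ht x, posterior_expectation_eq hV hint ha hb]
    refine (HasGradientAt.gradient ?_).symm
    unfold phiSI
    simp only [cgf_eq_log_tiltPartition]
    rw [hasGradientAt_iff_hasFDerivAt]
    refine hgrad.congr_fderiv (ContinuousLinearMap.ext fun w => ?_)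
    simp only [add_apply, smul_apply, smul_eq_mul,
      InnerProductSpace.toDual_apply_apply, inner_add_left, real_inner_smul_left]
    field_simp
  · have ha := hαpos p.1 hp.1
    have hb := hβpos p.1 hp.1
    have hs : 0 < β p.1 ^ 2 / (2 * α p.1 ^ 2) := by positivity
    have hα' : ContDiff ℝ 1 (deriv α) := hα.deriv'
    have hβ' : ContDiff ℝ 1 (deriv β) := hβ.deriv'
    have cα : ContDiffAt ℝ 1 (fun q : ℝ × Euc d => α q.1) p :=
      ((hα.of_le one_le_two).comp contDiff_fst).contDiffAt
    have cβ : ContDiffAt ℝ 1 (fun q : ℝ × Euc d => β q.1) p :=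
      ((hβ.of_le one_le_two).comp contDiff_fst).contDiffAt
    have cα' : ContDiffAt ℝ 1 (fun q : ℝ × Euc d => deriv α q.1) p :=
      (hα'.comp contDiff_fst).contDiffAt
    have cβ' : ContDiffAt ℝ 1 (fun q : ℝ × Euc d => deriv β q.1) p :=
      (hβ'.comp contDiff_fst).contDiffAt
    have cx : ContDiffAt ℝ 1 (fun q : ℝ × Euc d => q.2) p := contDiff_snd.contDiffAt
    have hparam : ContDiffAt ℝ 1 (fun q : ℝ × Euc d =>
        ((β q.1 ^ 2 / (2 * α q.1 ^ 2), (β q.1 / α q.1 ^ 2) • q.2) : ℝ × Euc d)) p :=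
      ((cβ.pow 2).div (contDiffAt_const.mul (cα.pow 2)) (by positivity)).prodMk
        ((cβ.div (cα.pow 2) (by positivity)).smul cx)
    have hlog := ((contDiffAt_tiltPartition hV hint hs).comp p hparam).log
      (tiltPartition_pos hV hint hs).ne'
    simp only [phiSI, cgf_eq_log_tiltPartition]
    exact ((cα'.div (contDiffAt_const.mul cα) (by positivity)).mul (cx.norm_sq ℝ)).add
      (((cβ'.sub ((cα'.mul cβ).div cα ha.ne')).mul ((cα.pow 2).div cβ hb.ne')).mul hlog)
end
end

section
/- Let μ0 = N(0, I_d) and let μ1(x) = e^{-V_1(x)} be a κ-log-concave probability density with V_1 ∈ C²(ℝ^d) and κ > 0. Let v_t be the velocity field of the isotropic stochastic interpolant with coefficients (α_t), (β_t), and let f^v_t be its flow map. Then for every t ∈ [0,1] and every x ∈ ℝ^d, ‖D f^v_t(x)‖_op ≤ √(α_t² + β_t²/κ). In particular, the time-one flow map f^v_1 is (1/√κ)-Lipschitz. -/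
open MeasureTheory Real Set
open scoped RealInnerProductSpace

noncomputable section

open scoped ENNReal NNReal

/-- One-dimensional Brunn–Minkowski inequality for compact sets. -/
theorem volume_add_volume_le_of_isCompact {K L C : Set ℝ} (hK : IsCompact K) (hL : IsCompact L)
    (hKn : K.Nonempty) (hLn : L.Nonempty) (h : ∀ a ∈ K, ∀ b ∈ L, a + b ∈ C) :
    volume K + volume L ≤ volume C := by
  obtain ⟨k, hk, hkm⟩ := hK.exists_isGreatest hKn
  obtain ⟨l, hl, hlm⟩ := hL.exists_isLeast hLn
  have hKL : (((· - l) ⁻¹' K) ∩ ((· - k) ⁻¹' L)) ⊆ {k + l} := by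
    rintro z ⟨h1, h2⟩
    have h1' := hkm h1
    have h2' := hlm h2
    simp only [mem_singleton_iff] at *
    linarith
  have hsub : (((· - l) ⁻¹' K) ∪ ((· - k) ⁻¹' L)) ⊆ C := by
    rintro z (h1 | h2)
    · simpa using h _ h1 l hl
    · simpa using h k hk _ h2
  have hmeas : MeasurableSet ((· - k) ⁻¹' L) := hL.measurableSet.preimage (by fun_prop)
  calc volume K + volume L
      = volume ((· - l) ⁻¹' K) + volume ((· - k) ⁻¹' L) := by
        simp only [sub_eq_add_neg, measure_preimage_add_right]
    _ = volume (((· - l) ⁻¹' K) ∪ ((· - k) ⁻¹' L)) := by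
        rw [← measure_union_add_inter _ hmeas, measure_mono_null hKL (by simp), add_zero]
    _ ≤ volume C := measure_mono hsub

/-- One-dimensional Brunn–Minkowski inequality. -/
theorem volume_add_volume_le {A B C : Set ℝ} (hA : MeasurableSet A) (hB : MeasurableSet B)
    (hAn : A.Nonempty) (hBn : B.Nonempty) (h : ∀ a ∈ A, ∀ b ∈ B, a + b ∈ C) :
    volume A + volume B ≤ volume C := by
  obtain ⟨a, ha⟩ := hAn
  obtain ⟨b, hb⟩ := hBn
  simp only [hA.measure_eq_iSup_isCompact volume, hB.measure_eq_iSup_isCompact volume, iSup_and']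
  refine ENNReal.biSup_add_biSup_le' ⟨∅, by simp⟩ ⟨∅, by simp⟩ fun K hK L hL => ?_
  calc volume K + volume L ≤ volume (insert a K) + volume (insert b L) := by
        gcongr <;> exact subset_insert _ _
    _ ≤ volume C :=
        volume_add_volume_le_of_isCompact (hK.2.insert a) (hL.2.insert b) (insert_nonempty _ _)
          (insert_nonempty _ _)
          fun x hx y hy => h x (insert_subset ha hK.1 hx) y (insert_subset hb hL.1 hy)

/-- One-dimensional Brunn–Minkowski inequality for midpoints. -/
theorem volume_add_volume_le_two_mul {A B C : Set ℝ} (hA : MeasurableSet A) (hB : MeasurableSet B)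
    (hAn : A.Nonempty) (hBn : B.Nonempty) (h : ∀ a ∈ A, ∀ b ∈ B, (a + b) / 2 ∈ C) :
    volume A + volume B ≤ 2 * volume C := by
  have := volume_add_volume_le (C := (· * (2 : ℝ)⁻¹) ⁻¹' C) hA hB hAn hBn
    (fun a ha b hb => by simpa [div_eq_mul_inv] using h a ha b hb)
  rwa [Real.volume_preimage_mul_right (by norm_num), inv_inv, abs_of_pos two_pos,
    ENNReal.ofReal_ofNat] at this

theorem ENNReal.mul_le_sq_of_add_le_two_mul {a b c : ℝ≥0∞} (h : a + b ≤ 2 * c) :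
    a * b ≤ c ^ 2 := by
  by_cases hc : c = ∞
  · simp [hc]
  have hab : a + b ≠ ∞ := ne_top_of_le_ne_top (by finiteness) h
  lift c to ℝ≥0 using hc
  lift a to ℝ≥0 using (ENNReal.add_ne_top.1 hab).1
  lift b to ℝ≥0 using (ENNReal.add_ne_top.1 hab).2
  norm_cast at h ⊢
  have h' : (a : ℝ) + b ≤ 2 * c := by exact_mod_cast h
  have : (a : ℝ) * b ≤ c ^ 2 := by nlinarith [sq_nonneg ((a : ℝ) - b), a.2, b.2, c.2]
  exact_mod_cast this

/-- Prékopa–Leindler inequality on the line for functions with supremum `1`, in the stronger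
arithmetic-mean form. -/
theorem lintegral_add_lintegral_le_two_mul {f g h : ℝ → ℝ} (hf : Measurable f) (hg : Measurable g)
    (hh : Measurable h) (hf0 : ∀ x, 0 ≤ f x) (hg0 : ∀ x, 0 ≤ g x) (hh0 : ∀ x, 0 ≤ h x)
    (hf1 : ∀ x, f x ≤ 1) (hg1 : ∀ x, g x ≤ 1) (hfs : ∀ t < 1, ∃ x, t < f x)
    (hgs : ∀ t < 1, ∃ x, t < g x) (H : ∀ x y, f x * g y ≤ h ((x + y) / 2) ^ 2) :
    (∫⁻ x, ENNReal.ofReal (f x)) + ∫⁻ x, ENNReal.ofReal (g x) ≤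
      2 * ∫⁻ x, ENNReal.ofReal (h x) := by
  rw [lintegral_eq_lintegral_meas_lt _ (.of_forall hf0) hf.aemeasurable,
    lintegral_eq_lintegral_meas_lt _ (.of_forall hg0) hg.aemeasurable,
    lintegral_eq_lintegral_meas_lt _ (.of_forall hh0) hh.aemeasurable]
  have hmono : ∀ k : ℝ → ℝ, Measurable fun t => volume {x | t < k x} := fun k =>
    Antitone.measurable fun s t hst => measure_mono fun x (hx : t < k x) => hst.trans_lt hx
  rw [← lintegral_add_left (hmono f), ← lintegral_const_mul _ (hmono h)]
  refine setLIntegral_mono ((hmono h).const_mul _) fun t ht => ?_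
  rw [mem_Ioi] at ht
  rcases lt_or_ge t 1 with ht1 | ht1
  · refine volume_add_volume_le_two_mul (measurableSet_lt measurable_const hf)
      (measurableSet_lt measurable_const hg) (hfs t ht1) (hgs t ht1) fun a ha b hb => ?_
    rw [mem_ofPred_eq] at *
    exact lt_of_pow_lt_pow_left₀ 2 (hh0 _) (by nlinarith [H a b])
  · have hf' : {x | t < f x} = ∅ := by ext x; simpa using (hf1 x).trans ht1
    have hg' : {x | t < g x} = ∅ := by ext x; simpa using (hg1 x).trans ht1
    simp [hf', hg']

/-- Prékopa–Leindler inequality on the line for bounded real functions. -/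
theorem lintegral_mul_lintegral_le_sq_of_bddAbove {f g h : ℝ → ℝ} (hf : Measurable f)
    (hg : Measurable g) (hh : Measurable h) (hf0 : ∀ x, 0 ≤ f x) (hg0 : ∀ x, 0 ≤ g x)
    (hh0 : ∀ x, 0 ≤ h x) (hfb : BddAbove (range f)) (hgb : BddAbove (range g))
    (H : ∀ x y, f x * g y ≤ h ((x + y) / 2) ^ 2) :
    (∫⁻ x, ENNReal.ofReal (f x)) * ∫⁻ x, ENNReal.ofReal (g x) ≤
      (∫⁻ x, ENNReal.ofReal (h x)) ^ 2 := by
  set M := ⨆ x, f x with hM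
  set N := ⨆ x, g x with hN
  have hfM : ∀ x, f x ≤ M := le_ciSup hfb
  have hgN : ∀ x, g x ≤ N := le_ciSup hgb
  rcases ((hf0 0).trans (hfM 0)).eq_or_lt with hM0 | hM0
  · have : ∀ x, ENNReal.ofReal (f x) = 0 := fun x => by simpa using (hfM x).trans hM0.ge
    simp [this]
  rcases ((hg0 0).trans (hgN 0)).eq_or_lt with hN0 | hN0
  · have : ∀ x, ENNReal.ofReal (g x) = 0 := fun x => by simpa using (hgN x).trans hN0.ge
    simp [this]
  have hs : 0 < √(M * N) := by positivity
  have scale : ∀ (k : ℝ → ℝ) (c : ℝ), Measurable k → 0 < c → (∫⁻ x, ENNReal.ofReal (k x)) =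
      ENNReal.ofReal c * ∫⁻ x, ENNReal.ofReal (k x / c) := by
    intro k c hk hc
    rw [← lintegral_const_mul _ (by fun_prop)]
    refine lintegral_congr fun x => ?_
    rw [← ENNReal.ofReal_mul hc.le, mul_div_cancel₀ _ hc.ne']
  have key := ENNReal.mul_le_sq_of_add_le_two_mul <| lintegral_add_lintegral_le_two_mul
    (hf.div_const M) (hg.div_const N) (hh.div_const √(M * N))
    (fun x => div_nonneg (hf0 x) hM0.le) (fun x => div_nonneg (hg0 x) hN0.le)
    (fun x => div_nonneg (hh0 x) hs.le) (fun x => (div_le_one hM0).2 (hfM x))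
    (fun x => (div_le_one hN0).2 (hgN x))
    (fun t ht => by
      obtain ⟨x, hx⟩ := exists_lt_of_lt_ciSup (show t * M < ⨆ x, f x by nlinarith)
      exact ⟨x, (lt_div_iff₀ hM0).2 hx⟩)
    (fun t ht => by
      obtain ⟨x, hx⟩ := exists_lt_of_lt_ciSup (show t * N < ⨆ x, g x by nlinarith)
      exact ⟨x, (lt_div_iff₀ hN0).2 hx⟩)
    (fun x y => by
      rw [div_pow, Real.sq_sqrt (by positivity), div_mul_div_comm]
      gcongr
      exact H x y)
  rw [scale f M hf hM0, scale g N hg hN0, scale h _ hh hs, mul_mul_mul_comm, mul_pow,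
    ← ENNReal.ofReal_mul hM0.le, ← ENNReal.ofReal_pow hs.le, Real.sq_sqrt (by positivity)]
  gcongr

theorem lintegral_eq_iSup_lintegral_min {α : Type*} [MeasurableSpace α] {μ : Measure α}
    {f : α → ℝ≥0∞} (hf : Measurable f) : ∫⁻ x, f x ∂μ = ⨆ n : ℕ, ∫⁻ x, min (f x) n ∂μ := by
  rw [← lintegral_iSup (fun n => hf.min measurable_const)
    (fun m n hmn x => min_le_min_left _ (by exact_mod_cast hmn))]
  refine lintegral_congr fun x => ?_
  rw [← inf_iSup_eq, ENNReal.iSup_natCast, inf_top_eq]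

/-- Prékopa–Leindler inequality on the line. -/
theorem lintegral_mul_lintegral_le_sq_real {f g h : ℝ → ℝ≥0∞} (hf : Measurable f)
    (hg : Measurable g) (hh : Measurable h) (H : ∀ x y, f x * g y ≤ h ((x + y) / 2) ^ 2) :
    (∫⁻ x, f x) * ∫⁻ x, g x ≤ (∫⁻ x, h x) ^ 2 := by
  have key : ∀ n : ℕ, (∫⁻ x, min (f x) n) * ∫⁻ x, min (g x) n ≤ (∫⁻ x, h x) ^ 2 := by
    intro n
    have hfin : ∀ a : ℝ≥0∞, min a n ≠ ∞ := fun a => ne_top_of_le_ne_top (by simp) (min_le_right _ _)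
    have hbdd : ∀ k : ℝ → ℝ≥0∞, BddAbove (range fun x => (min (k x) n).toReal) := by
      rintro k
      refine ⟨n, ?_⟩
      rintro _ ⟨x, rfl⟩
      exact ENNReal.toReal_le_of_le_ofReal (by simp) (by simp)
    have := lintegral_mul_lintegral_le_sq_of_bddAbove
      (hf.min measurable_const).ennreal_toReal (hg.min measurable_const).ennreal_toReal
      (hh.min measurable_const).ennreal_toReal (fun x => by positivity) (fun x => by positivity)
      (fun x => by positivity) (hbdd f) (hbdd g)
      (fun x y => by
        rw [← ENNReal.toReal_mul, ← ENNReal.toReal_pow]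
        refine ENNReal.toReal_mono (ENNReal.pow_ne_top (hfin _)) ?_
        rcases min_choice (h ((x + y) / 2)) n with h1 | h1 <;> rw [h1]
        · exact (mul_le_mul' (min_le_left _ _) (min_le_left _ _)).trans (H x y)
        · rw [sq]; exact mul_le_mul' (min_le_right _ _) (min_le_right _ _))
    simp only [ENNReal.ofReal_toReal (hfin _)] at this
    refine this.trans ?_
    gcongr
    exact min_le_left _ _
  rw [lintegral_eq_iSup_lintegral_min hf, lintegral_eq_iSup_lintegral_min hg, ENNReal.iSup_mul]
  refine iSup_le fun m => ?_
  rw [ENNReal.mul_iSup]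
  refine iSup_le fun n => le_trans ?_ (key (max m n))
  gcongr <;> simp

/-- Prékopa–Leindler inequality for midpoints on `ℝⁿ`. -/
theorem lintegral_mul_lintegral_le_sq_pi {n : ℕ} {f g h : (Fin n → ℝ) → ℝ≥0∞} (hf : Measurable f)
    (hg : Measurable g) (hh : Measurable h)
    (H : ∀ x y, f x * g y ≤ h ((2 : ℝ)⁻¹ • (x + y)) ^ 2) :
    (∫⁻ x, f x) * ∫⁻ x, g x ≤ (∫⁻ x, h x) ^ 2 := by
  induction n with
  | zero =>
    simp only [lintegral_unique, Measure.volume_pi_eq_dirac (0 : Fin 0 → ℝ), measure_univ, mul_one]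
    convert H default default
  | succ n ih =>
    have hmp := (volume_preserving_piFinSuccAbove (fun _ : Fin (n + 1) => ℝ) 0).symm
    have he : ∀ p : ℝ × (Fin n → ℝ),
        (MeasurableEquiv.piFinSuccAbove (fun _ : Fin (n + 1) => ℝ) 0).symm p =
          Fin.cons p.1 p.2 := fun p => by
      rw [← Fin.insertNth_zero']
      rfl
    have hcons : ∀ k : (Fin (n + 1) → ℝ) → ℝ≥0∞, Measurable k →
        Measurable (fun p : ℝ × (Fin n → ℝ) => k (Fin.cons p.1 p.2)) := fun k hk => by
      simp only [← he]
      exact hk.comp (MeasurableEquiv.piFinSuccAbove (fun _ : Fin (n + 1) => ℝ) 0).symm.measurable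
    have hint : ∀ k : (Fin (n + 1) → ℝ) → ℝ≥0∞, Measurable k →
        ∫⁻ x, k x = ∫⁻ t : ℝ, ∫⁻ x : Fin n → ℝ, k (Fin.cons t x) := by
      intro k hk
      rw [← hmp.lintegral_comp hk, Measure.volume_eq_prod, lintegral_prod]
      · simp only [he]
      · simp only [he]
        exact (hcons k hk).aemeasurable
    rw [hint f hf, hint g hg, hint h hh]
    refine lintegral_mul_lintegral_le_sq_real (hcons f hf).lintegral_prod_right'
      (hcons g hg).lintegral_prod_right' (hcons h hh).lintegral_prod_right' fun s t => ?_
    refine ih ((hcons f hf).comp measurable_prodMk_left) ((hcons g hg).comp measurable_prodMk_left)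
      ((hcons h hh).comp measurable_prodMk_left) fun x y => ?_
    convert H (Fin.cons s x) (Fin.cons t y) using 3
    ext i
    refine Fin.cases ?_ (fun i => ?_) i <;> simp [div_eq_inv_mul, mul_add]

/-- Prékopa–Leindler inequality for midpoints on Euclidean space. -/
theorem lintegral_mul_lintegral_le_sq {d : ℕ} {f g h : EuclideanSpace ℝ (Fin d) → ℝ≥0∞}
    (hf : Measurable f) (hg : Measurable g) (hh : Measurable h)
    (H : ∀ x y, f x * g y ≤ h ((2 : ℝ)⁻¹ • (x + y)) ^ 2) :
    (∫⁻ x, f x) * ∫⁻ x, g x ≤ (∫⁻ x, h x) ^ 2 := by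
  have hmp := PiLp.volume_preserving_toLp (Fin d)
  rw [← hmp.lintegral_comp hf, ← hmp.lintegral_comp hg, ← hmp.lintegral_comp hh]
  exact lintegral_mul_lintegral_le_sq_pi (hf.comp hmp.measurable) (hg.comp hmp.measurable)
    (hh.comp hmp.measurable) fun x y => H _ _

section StrongConvexity

variable {E : Type*} [NormedAddCommGroup E] [NormedSpace ℝ E] {V : E → ℝ} {κ : ℝ}

theorem convexOn_line_sub_sq (hV : ContDiff ℝ 2 V)
    (hlc : ∀ x w : E, κ * ‖w‖ ^ 2 ≤ iteratedFDeriv ℝ 2 V x ![w, w]) (y u : E) :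
    ConvexOn ℝ univ (fun s : ℝ => V (y + s • u) - κ / 2 * ‖u‖ ^ 2 * s ^ 2) ∧
      HasDerivAt (fun s : ℝ => V (y + s • u) - κ / 2 * ‖u‖ ^ 2 * s ^ 2) (fderiv ℝ V y u) 0 := by
  have hline : ∀ s : ℝ, HasDerivAt (fun s : ℝ => y + s • u) u s := fun s => by
    simpa using ((hasDerivAt_id s).smul_const u).const_add y
  have hV1 : Differentiable ℝ V := hV.differentiable (by norm_num)
  have hV2 : Differentiable ℝ (fderiv ℝ V) :=
    (hV.fderiv_right (m := 1) (by norm_num)).differentiable (by norm_num)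
  have h1 : ∀ s : ℝ, HasDerivAt (fun s : ℝ => V (y + s • u) - κ / 2 * ‖u‖ ^ 2 * s ^ 2)
      (fderiv ℝ V (y + s • u) u - κ * ‖u‖ ^ 2 * s) s := fun s => by
    refine (((hV1 _).hasFDerivAt.comp_hasDerivAt s (hline s)).fun_sub
      ((hasDerivAt_pow 2 s).const_mul (κ / 2 * ‖u‖ ^ 2))).congr_deriv ?_
    push_cast
    ring
  have h2 : ∀ s : ℝ, HasDerivAt (fun s : ℝ => fderiv ℝ V (y + s • u) u - κ * ‖u‖ ^ 2 * s)
      (fderiv ℝ (fderiv ℝ V) (y + s • u) u u - κ * ‖u‖ ^ 2) s := fun s => by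
    simpa using (((hV2 _).hasFDerivAt.comp_hasDerivAt s (hline s)).clm_apply
      (hasDerivAt_const s u)).fun_sub ((hasDerivAt_id s).const_mul (κ * ‖u‖ ^ 2))
  have hd1 : deriv (fun s : ℝ => V (y + s • u) - κ / 2 * ‖u‖ ^ 2 * s ^ 2) =
      fun s => fderiv ℝ V (y + s • u) u - κ * ‖u‖ ^ 2 * s := funext fun s => (h1 s).deriv
  refine ⟨?_, by simpa using h1 0⟩
  refine convexOn_univ_of_deriv2_nonneg (fun s => (h1 s).differentiableAt) ?_ fun s => ?_
  · rw [hd1]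
    exact fun s => (h2 s).differentiableAt
  · rw [Function.iterate_succ, Function.iterate_one, Function.comp_apply, hd1, (h2 s).deriv]
    have := hlc (y + s • u) u
    rw [iteratedFDeriv_two_apply] at this
    simpa using this

theorem add_le_sub_sq_of_hessian (hV : ContDiff ℝ 2 V)
    (hlc : ∀ x w : E, κ * ‖w‖ ^ 2 ≤ iteratedFDeriv ℝ 2 V x ![w, w]) (x y : E) :
    2 * V ((2 : ℝ)⁻¹ • (x + y)) ≤ V x + V y - κ / 4 * ‖x - y‖ ^ 2 := by
  have h := (convexOn_line_sub_sq hV hlc y (x - y)).1.2 (mem_univ 0) (mem_univ 1)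
    (show (0 : ℝ) ≤ 2⁻¹ by norm_num) (show (0 : ℝ) ≤ 2⁻¹ by norm_num) (by norm_num)
  have h2 : y + (2 : ℝ)⁻¹ • (x - y) = (2 : ℝ)⁻¹ • (x + y) := by module
  simp only [smul_eq_mul, mul_zero, mul_one, zero_add, zero_smul, add_zero, one_smul,
    add_sub_cancel, h2] at h
  linarith

theorem quadratic_lower_bound_of_hessian (hV : ContDiff ℝ 2 V)
    (hlc : ∀ x w : E, κ * ‖w‖ ^ 2 ≤ iteratedFDeriv ℝ 2 V x ![w, w]) (x u : E) :
    V x + fderiv ℝ V x u + κ / 2 * ‖u‖ ^ 2 ≤ V (x + u) := by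
  obtain ⟨h1, h2⟩ := convexOn_line_sub_sq hV hlc x u
  have := h1.deriv_le_slope (mem_univ 0) (mem_univ 1) one_pos h2.differentiableAt
  rw [h2.deriv, slope_def_field] at this
  simp at this
  linarith

end StrongConvexity

/-- A midpoint-concave function lies below its tangents. -/
theorem le_add_deriv_of_midpoint_concave {φ : ℝ → ℝ} {φ' : ℝ}
    (hmid : ∀ s, φ 0 + φ s ≤ 2 * φ (s / 2)) (hφ : HasDerivAt φ φ' 0) : φ 1 ≤ φ 0 + φ' := by
  have hstep : ∀ n : ℕ, φ 1 - φ 0 ≤ 2 ^ n * (φ ((1 / 2) ^ n) - φ 0) := by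
    intro n
    induction n with
    | zero => simp
    | succ n ih =>
      have := hmid ((1 / 2) ^ n)
      rw [show ((1 : ℝ) / 2) ^ n / 2 = (1 / 2) ^ (n + 1) by ring] at this
      calc φ 1 - φ 0 ≤ 2 ^ n * (φ ((1 / 2) ^ n) - φ 0) := ih
        _ ≤ 2 ^ n * (2 * (φ ((1 / 2) ^ (n + 1)) - φ 0)) := by gcongr; linarith
        _ = _ := by ring
  have hlim : Filter.Tendsto (fun n : ℕ => ((1 : ℝ) / 2) ^ n) Filter.atTop (nhdsWithin 0 {0}ᶜ) :=
    tendsto_nhdsWithin_iff.2 ⟨tendsto_pow_atTop_nhds_zero_of_lt_one (by norm_num) (by norm_num),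
      .of_forall fun n => by simp⟩
  have := ge_of_tendsto ((hasDerivAt_iff_tendsto_slope.1 hφ).comp hlim)
    (Filter.Eventually.of_forall (f := Filter.atTop) (p := fun n : ℕ => φ 1 - φ 0 ≤ _) fun n => by
      have := hstep n
      rw [Function.comp_apply, slope_def_field, sub_zero, one_div, inv_pow, div_inv_eq_mul,
        mul_comm]
      simpa using this)
  linarith

theorem abs_exp_neg_sq_sub_le (a b : ℝ) :
    |Real.exp (-a ^ 2 / 2) - Real.exp (-b ^ 2 / 2)| ≤ |a - b| := by
  have hd : ∀ x : ℝ, HasDerivAt (fun x : ℝ => Real.exp (-x ^ 2 / 2))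
      (Real.exp (-x ^ 2 / 2) * -x) x := fun x => by
    refine ((hasDerivAt_pow 2 x).fun_neg.div_const 2).exp.congr_deriv ?_
    push_cast
    ring
  have hb : ∀ x : ℝ, ‖Real.exp (-x ^ 2 / 2) * -x‖ ≤ 1 := fun x => by
    rw [norm_mul, norm_neg, Real.norm_eq_abs, Real.norm_eq_abs, abs_of_pos (Real.exp_pos _),
      show -x ^ 2 / 2 = -(x ^ 2 / 2) by ring, Real.exp_neg, inv_mul_le_iff₀ (Real.exp_pos _),
      mul_one]
    nlinarith [Real.add_one_le_exp (x ^ 2 / 2), sq_abs x, sq_nonneg (|x| - 1)]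
  simpa using Convex.norm_image_sub_le_of_norm_hasDerivWithin_le (s := univ)
    (fun x _ => (hd x).hasDerivWithinAt) (fun x _ => hb x) convex_univ (mem_univ b) (mem_univ a)

theorem mul_exp_neg_sq_le (a : ℝ) : |a| * Real.exp (-a ^ 2 / 2) ≤ 1 := by
  rw [show -a ^ 2 / 2 = -(a ^ 2 / 2) by ring, Real.exp_neg, ← div_eq_mul_inv,
    div_le_one (Real.exp_pos _)]
  nlinarith [Real.add_one_le_exp (a ^ 2 / 2), sq_abs a, sq_nonneg (|a| - 1)]

theorem integrable_norm_mul_exp_neg {d : ℕ} {V : EuclideanSpace ℝ (Fin d) → ℝ} {κ : ℝ} (hκ : 0 < κ)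
    (hV : ContDiff ℝ 2 V)
    (hlc : ∀ x w, κ * ‖w‖ ^ 2 ≤ iteratedFDeriv ℝ 2 V x ![w, w]) :
    Integrable (fun y => ‖y‖ * Real.exp (-V y)) := by
  have hgauss : Integrable fun y : EuclideanSpace ℝ (Fin d) => Real.exp (-(κ / 4) * ‖y‖ ^ 2) := by
    have := (GaussianFourier.integrable_cexp_neg_mul_sq_norm_add (b := ((κ / 4 : ℝ) : ℂ))
      (by simpa using hκ) 0 (0 : EuclideanSpace ℝ (Fin d))).norm
    refine this.congr (.of_forall fun y => ?_)
    simp [Complex.norm_exp, ← Complex.ofReal_pow]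
  set b := ‖fderiv ℝ V 0‖ + 1 with hb
  refine (hgauss.const_mul (Real.exp (-V 0 + b ^ 2 / κ))).mono'
    (by have := hV.continuous; fun_prop) (.of_forall fun y => ?_)
  rw [Real.norm_of_nonneg (by positivity), ← Real.exp_add]
  calc ‖y‖ * Real.exp (-V y) ≤ Real.exp ‖y‖ * Real.exp (-V y) := by
        gcongr
        linarith [Real.add_one_le_exp ‖y‖]
    _ ≤ _ := by
      rw [← Real.exp_add, Real.exp_le_exp]
      have h1 := quadratic_lower_bound_of_hessian hV hlc 0 y
      rw [zero_add] at h1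
      have h2 : -(‖fderiv ℝ V 0‖ * ‖y‖) ≤ fderiv ℝ V 0 y :=
        neg_le_of_abs_le ((fderiv ℝ V 0).le_opNorm y)
      have h3 : b * ‖y‖ ≤ b ^ 2 / κ + κ / 4 * ‖y‖ ^ 2 := by
        rw [div_add' _ _ _ hκ.ne', le_div_iff₀ hκ]
        nlinarith [sq_nonneg (b - κ / 2 * ‖y‖)]
      have h4 : b * ‖y‖ = ‖fderiv ℝ V 0‖ * ‖y‖ + ‖y‖ := by rw [hb]; ring
      linarith

theorem norm_inv_max_smul_sub_le {E : Type*} [NormedAddCommGroup E] [NormedSpace ℝ E] {c : ℝ}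
    (hc : 0 < c) (p q : ℝ) (x y : E) :
    ‖(max p c)⁻¹ • x - (max q c)⁻¹ • y‖ ≤ c⁻¹ * ‖x - y‖ + c⁻¹ * c⁻¹ * |p - q| * ‖y‖ := by
  have hpos : ∀ p, 0 < max p c := fun p => lt_max_of_lt_right hc
  have hinv : ∀ p, (max p c)⁻¹ ≤ c⁻¹ := fun p => inv_anti₀ hc (le_max_right _ _)
  have hinv0 : ∀ p, 0 ≤ (max p c)⁻¹ := fun p => (inv_pos.2 (hpos p)).le
  have hab : |(max p c)⁻¹ - (max q c)⁻¹| ≤ c⁻¹ * c⁻¹ * |p - q| := by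
    rw [inv_sub_inv (hpos p).ne' (hpos q).ne', abs_div, abs_mul, abs_of_pos (hpos p),
      abs_of_pos (hpos q), div_eq_inv_mul, mul_inv, abs_sub_comm]
    refine mul_le_mul (mul_le_mul (hinv _) (hinv _) (hinv0 _) (by positivity))
      (abs_max_sub_max_le_abs _ _ _) (abs_nonneg _) (by positivity)
  calc ‖(max p c)⁻¹ • x - (max q c)⁻¹ • y‖
      = ‖(max p c)⁻¹ • (x - y) + ((max p c)⁻¹ - (max q c)⁻¹) • y‖ := by congr 1; module
    _ ≤ (max p c)⁻¹ * ‖x - y‖ + |(max p c)⁻¹ - (max q c)⁻¹| * ‖y‖ := by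
        refine (norm_add_le _ _).trans_eq ?_
        rw [norm_smul, norm_smul, Real.norm_of_nonneg (hinv0 _), Real.norm_eq_abs]
    _ ≤ _ := by
        gcongr
        exact le_max_right _ _

section Posterior

variable {d : ℕ}

/-- Unnormalized density of `X₁` given `X₀ + ρ X₁ = z`, for `X₀` standard Gaussian and
`X₁ ∼ e^{-V}`. -/
def posteriorWeight (V : EuclideanSpace ℝ (Fin d) → ℝ) (ρ : ℝ) (z y : EuclideanSpace ℝ (Fin d)) :
    ℝ :=
  Real.exp (-V y - ‖z - ρ • y‖ ^ 2 / 2)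

/-- Normalizing constant of `posteriorWeight`. -/
def posteriorMass (V : EuclideanSpace ℝ (Fin d) → ℝ) (ρ : ℝ) (z : EuclideanSpace ℝ (Fin d)) : ℝ :=
  ∫ y, posteriorWeight V ρ z y

/-- Unnormalized first moment of `posteriorWeight`. -/
def posteriorMoment (V : EuclideanSpace ℝ (Fin d) → ℝ) (ρ : ℝ) (z : EuclideanSpace ℝ (Fin d)) :
    EuclideanSpace ℝ (Fin d) :=
  ∫ y, posteriorWeight V ρ z y • y

/-- Mean of `X₁` given `X₀ + ρ X₁ = z`. -/
def posteriorMean (V : EuclideanSpace ℝ (Fin d) → ℝ) (ρ : ℝ) (z : EuclideanSpace ℝ (Fin d)) :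
    EuclideanSpace ℝ (Fin d) :=
  (posteriorMass V ρ z)⁻¹ • posteriorMoment V ρ z

variable {V : EuclideanSpace ℝ (Fin d) → ℝ} {κ : ℝ}

theorem posteriorWeight_eq (ρ : ℝ) (z y : EuclideanSpace ℝ (Fin d)) :
    posteriorWeight V ρ z y = Real.exp (-V y) * Real.exp (-‖z - ρ • y‖ ^ 2 / 2) := by
  rw [posteriorWeight, ← Real.exp_add]
  ring_nf

theorem posteriorWeight_pos (ρ : ℝ) (z y : EuclideanSpace ℝ (Fin d)) :
    0 < posteriorWeight V ρ z y := Real.exp_pos _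

theorem posteriorWeight_le (ρ : ℝ) (z y : EuclideanSpace ℝ (Fin d)) :
    posteriorWeight V ρ z y ≤ Real.exp (-V y) := by
  rw [posteriorWeight, Real.exp_le_exp]
  have : 0 ≤ ‖z - ρ • y‖ ^ 2 / 2 := by positivity
  linarith

theorem continuous_posteriorWeight (hV : Continuous V) (ρ : ℝ) (z : EuclideanSpace ℝ (Fin d)) :
    Continuous (posteriorWeight V ρ z) := by
  unfold posteriorWeight
  fun_prop

theorem abs_posteriorWeight_sub_le (ρ : ℝ) (z z' y : EuclideanSpace ℝ (Fin d)) :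
    |posteriorWeight V ρ z y - posteriorWeight V ρ z' y| ≤ Real.exp (-V y) * ‖z - z'‖ := by
  rw [posteriorWeight_eq, posteriorWeight_eq, ← mul_sub, abs_mul, abs_of_pos (Real.exp_pos _)]
  gcongr
  refine (abs_exp_neg_sq_sub_le _ _).trans ((abs_norm_sub_norm_le _ _).trans_eq ?_)
  congr 1
  abel

theorem integrable_posteriorWeight (hV : Continuous V)
    (hi : Integrable fun y => Real.exp (-V y)) (ρ : ℝ) (z : EuclideanSpace ℝ (Fin d)) :
    Integrable (posteriorWeight V ρ z) :=
  hi.mono' (continuous_posteriorWeight hV ρ z).aestronglyMeasurable <| .of_forall fun y => by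
    rw [Real.norm_of_nonneg (posteriorWeight_pos _ _ _).le]
    exact posteriorWeight_le _ _ _

theorem norm_posteriorWeight_smul_le (ρ : ℝ) (z y : EuclideanSpace ℝ (Fin d)) :
    ‖posteriorWeight V ρ z y • y‖ ≤ ‖y‖ * Real.exp (-V y) := by
  rw [norm_smul, Real.norm_of_nonneg (posteriorWeight_pos _ _ _).le, mul_comm]
  gcongr
  exact posteriorWeight_le _ _ _

theorem integrable_posteriorWeight_smul (hV : Continuous V)
    (hi1 : Integrable fun y => ‖y‖ * Real.exp (-V y)) (ρ : ℝ) (z : EuclideanSpace ℝ (Fin d)) :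
    Integrable fun y => posteriorWeight V ρ z y • y :=
  hi1.mono' ((continuous_posteriorWeight hV ρ z).smul continuous_id).aestronglyMeasurable <|
    .of_forall fun _ => norm_posteriorWeight_smul_le _ _ _

theorem posteriorMass_pos (hV : Continuous V)
    (hi : Integrable fun y => Real.exp (-V y)) (ρ : ℝ) (z : EuclideanSpace ℝ (Fin d)) :
    0 < posteriorMass V ρ z :=
  integral_exp_pos (integrable_posteriorWeight hV hi ρ z)

theorem continuous_posteriorMass (hV : Continuous V) (hi : Integrable fun y => Real.exp (-V y)) :
    Continuous fun p : ℝ × EuclideanSpace ℝ (Fin d) => posteriorMass V p.1 p.2 := by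
  refine continuous_of_dominated
    (fun p => (continuous_posteriorWeight hV p.1 p.2).aestronglyMeasurable)
    (fun p => .of_forall fun y => ?_) hi (.of_forall fun y => ?_)
  · rw [Real.norm_of_nonneg (posteriorWeight_pos _ _ _).le]
    exact posteriorWeight_le _ _ _
  · unfold posteriorWeight
    fun_prop

theorem continuous_posteriorMoment (hV : Continuous V)
    (hi1 : Integrable fun y => ‖y‖ * Real.exp (-V y)) :
    Continuous fun p : ℝ × EuclideanSpace ℝ (Fin d) => posteriorMoment V p.1 p.2 := by
  refine continuous_of_dominated
    (fun p => ((continuous_posteriorWeight hV p.1 p.2).smul continuous_id).aestronglyMeasurable)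
    (fun p => .of_forall fun _ => norm_posteriorWeight_smul_le _ _ _) hi1 (.of_forall fun y => ?_)
  unfold posteriorWeight
  fun_prop

theorem abs_posteriorMass_sub_le (hV : Continuous V) (hi : Integrable fun y => Real.exp (-V y))
    (ρ : ℝ) (z z' : EuclideanSpace ℝ (Fin d)) :
    |posteriorMass V ρ z - posteriorMass V ρ z'| ≤ (∫ y, Real.exp (-V y)) * ‖z - z'‖ := by
  rw [posteriorMass, posteriorMass, ← integral_sub (integrable_posteriorWeight hV hi _ _)
    (integrable_posteriorWeight hV hi _ _), ← integral_mul_const]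
  exact norm_integral_le_of_norm_le
    (f := fun y => posteriorWeight V ρ z y - posteriorWeight V ρ z' y)
    (hi.mul_const _) (.of_forall fun y => abs_posteriorWeight_sub_le _ _ _ _)

theorem norm_posteriorMoment_sub_le (hV : Continuous V)
    (hi1 : Integrable fun y => ‖y‖ * Real.exp (-V y))
    (ρ : ℝ) (z z' : EuclideanSpace ℝ (Fin d)) :
    ‖posteriorMoment V ρ z - posteriorMoment V ρ z'‖ ≤
      (∫ y, ‖y‖ * Real.exp (-V y)) * ‖z - z'‖ := by
  rw [posteriorMoment, posteriorMoment, ← integral_sub (integrable_posteriorWeight_smul hV hi1 _ _)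
    (integrable_posteriorWeight_smul hV hi1 _ _), ← integral_mul_const]
  refine norm_integral_le_of_norm_le (hi1.mul_const _) (.of_forall fun y => ?_)
  rw [← sub_smul, norm_smul, mul_comm, mul_assoc]
  gcongr
  exact abs_posteriorWeight_sub_le _ _ _ _

theorem norm_posteriorMoment_le (hi1 : Integrable fun y => ‖y‖ * Real.exp (-V y))
    (ρ : ℝ) (z : EuclideanSpace ℝ (Fin d)) :
    ‖posteriorMoment V ρ z‖ ≤ ∫ y, ‖y‖ * Real.exp (-V y) :=
  norm_integral_le_of_norm_le hi1 (.of_forall fun _ => norm_posteriorWeight_smul_le _ _ _)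

/-- The normalizing constant of a strongly log-concave family is strongly log-concave. -/
theorem posteriorMass_mul_le (hκ : 0 < κ) (hV : Continuous V)
    (hi : Integrable fun y => Real.exp (-V y))
    (hmid : ∀ x y, 2 * V ((2 : ℝ)⁻¹ • (x + y)) ≤ V x + V y - κ / 4 * ‖x - y‖ ^ 2)
    (ρ : ℝ) (z z' : EuclideanSpace ℝ (Fin d)) :
    posteriorMass V ρ z * posteriorMass V ρ z' ≤
      (Real.exp (-(κ / (κ + ρ ^ 2) * ‖z - z'‖ ^ 2 / 8)) *
        posteriorMass V ρ ((2 : ℝ)⁻¹ • (z + z'))) ^ 2 := by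
  have hmass : ∀ (c : ℝ) (z : EuclideanSpace ℝ (Fin d)), 0 < c →
      ∫⁻ y, ENNReal.ofReal (c * posteriorWeight V ρ z y) =
        ENNReal.ofReal (c * posteriorMass V ρ z) := by
    intro c z hc
    rw [posteriorMass, ← integral_const_mul, ofReal_integral_eq_lintegral_ofReal
      ((integrable_posteriorWeight hV hi ρ z).const_mul c)
      (.of_forall fun y => mul_nonneg hc.le (posteriorWeight_pos _ _ _).le)]
  have hm : ∀ (c : ℝ) (z : EuclideanSpace ℝ (Fin d)),
      Measurable fun y => ENNReal.ofReal (c * posteriorWeight V ρ z y) := fun c z =>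
    ((continuous_posteriorWeight hV ρ z).measurable.const_mul c).ennreal_ofReal
  set c := Real.exp (-(κ / (κ + ρ ^ 2) * ‖z - z'‖ ^ 2 / 8)) with hc
  have key := lintegral_mul_lintegral_le_sq (hm 1 z) (hm 1 z') (hm c ((2 : ℝ)⁻¹ • (z + z')))
    fun x y => by
      rw [← ENNReal.ofReal_mul (by have := posteriorWeight_pos (V := V) ρ z x; positivity),
        ← ENNReal.ofReal_pow (by
          have := posteriorWeight_pos (V := V) ρ ((2 : ℝ)⁻¹ • (z + z')) ((2 : ℝ)⁻¹ • (x + y))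
          positivity)]
      refine ENNReal.ofReal_le_ofReal ?_
      rw [one_mul, one_mul, posteriorWeight, posteriorWeight, posteriorWeight, hc, ← Real.exp_add,
        ← Real.exp_add, ← Real.exp_nat_mul, Real.exp_le_exp]
      have h1 := parallelogram_law_with_norm ℝ (z - ρ • x) (z' - ρ • y)
      have h2 : (2 : ℝ)⁻¹ • (z + z') - ρ • (2 : ℝ)⁻¹ • (x + y) =
          (2 : ℝ)⁻¹ • ((z - ρ • x) + (z' - ρ • y)) := by module
      have h3 : ‖z - z'‖ ≤ ‖(z - ρ • x) - (z' - ρ • y)‖ + |ρ| * ‖x - y‖ := by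
        rw [← Real.norm_eq_abs, ← norm_smul]
        refine (norm_add_le _ _).trans_eq' ?_
        congr 1
        module
      have h4 : κ / (κ + ρ ^ 2) * ‖z - z'‖ ^ 2 ≤
          κ * ‖x - y‖ ^ 2 + ‖(z - ρ • x) - (z' - ρ • y)‖ ^ 2 := by
        have h5 : ‖z - z'‖ ^ 2 ≤ (‖(z - ρ • x) - (z' - ρ • y)‖ + |ρ| * ‖x - y‖) ^ 2 := by gcongr
        rw [div_mul_eq_mul_div, div_le_iff₀ (by positivity)]
        generalize ‖(z - ρ • x) - (z' - ρ • y)‖ = p at *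
        rw [← sq_abs ρ]
        nlinarith [sq_nonneg (κ * ‖x - y‖ - |ρ| * p), mul_le_mul_of_nonneg_left h5 hκ.le]
      rw [h2, norm_smul, Real.norm_of_nonneg (by norm_num)]
      have := hmid x y
      push_cast
      nlinarith
  have hpos := posteriorMass_pos hV hi ρ
  rw [hmass 1 z one_pos, hmass 1 z' one_pos, hmass c _ (Real.exp_pos _), one_mul, one_mul,
    ← ENNReal.ofReal_mul (hpos z).le,
    ← ENNReal.ofReal_pow (mul_nonneg (Real.exp_pos _).le (hpos _).le)] at key
  exact (ENNReal.ofReal_le_ofReal_iff (by positivity)).1 key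

theorem hasDerivAt_posteriorMass_line (hV : Continuous V)
    (hi : Integrable fun y => Real.exp (-V y)) (hi1 : Integrable fun y => ‖y‖ * Real.exp (-V y))
    (ρ : ℝ) (z u : EuclideanSpace ℝ (Fin d)) :
    HasDerivAt (fun s : ℝ => posteriorMass V ρ (z + s • u))
      (-⟪z, u⟫ * posteriorMass V ρ z + ρ * ⟪posteriorMoment V ρ z, u⟫) 0 := by
  have hw := integrable_posteriorWeight hV hi ρ z
  have hline : ∀ (y : EuclideanSpace ℝ (Fin d)) (s : ℝ),
      HasDerivAt (fun s : ℝ => z + s • u - ρ • y) u s := fun y s => by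
    simpa using (((hasDerivAt_id s).smul_const u).const_add z).sub_const (ρ • y)
  have key := (hasDerivAt_integral_of_dominated_loc_of_deriv_le (μ := volume)
    (F := fun (s : ℝ) y => posteriorWeight V ρ (z + s • u) y)
    (F' := fun s y => posteriorWeight V ρ (z + s • u) y * -⟪z + s • u - ρ • y, u⟫)
    (bound := fun y => Real.exp (-V y) * ‖u‖) (x₀ := (0 : ℝ)) Filter.univ_mem
    (.of_forall fun s => (continuous_posteriorWeight hV _ _).aestronglyMeasurable)
    (integrable_posteriorWeight hV hi _ _)
    (by have := continuous_posteriorWeight hV ρ (z + (0 : ℝ) • u); fun_prop)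
    (.of_forall fun y s _ => ?_) (hi.mul_const _) (.of_forall fun y s _ => ?_)).2
  · refine key.congr_deriv ?_
    simp only [zero_smul, add_zero]
    rw [posteriorMass, posteriorMoment, ← integral_const_mul,
      real_inner_comm u (∫ y, posteriorWeight V ρ z y • y),
      ← integral_inner (integrable_posteriorWeight_smul hV hi1 ρ z), ← integral_const_mul,
      ← integral_add (hw.const_mul _)
        (((integrable_posteriorWeight_smul hV hi1 ρ z).const_inner u).const_mul ρ)]
    refine integral_congr_ae (.of_forall fun y => ?_)
    simp only [inner_sub_left, real_inner_smul_left, real_inner_smul_right, real_inner_comm u y]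
    ring
  · rw [norm_mul, norm_neg, Real.norm_of_nonneg (posteriorWeight_pos _ _ _).le, posteriorWeight_eq,
      mul_assoc]
    gcongr
    refine (mul_le_mul_of_nonneg_left (norm_inner_le_norm _ _) (Real.exp_pos _).le).trans ?_
    have := mul_exp_neg_sq_le ‖z + s • u - ρ • y‖
    rw [abs_norm] at this
    nlinarith [norm_nonneg u]
  · refine (((hline y s).norm_sq.div_const 2).const_sub (-V y)).exp.congr_deriv ?_
    rw [posteriorWeight]
    ring

theorem inner_posteriorMean_tangent (hκ : 0 < κ) (hV : Continuous V)
    (hi : Integrable fun y => Real.exp (-V y)) (hi1 : Integrable fun y => ‖y‖ * Real.exp (-V y))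
    (hmid : ∀ x y, 2 * V ((2 : ℝ)⁻¹ • (x + y)) ≤ V x + V y - κ / 4 * ‖x - y‖ ^ 2)
    (ρ : ℝ) (z u : EuclideanSpace ℝ (Fin d)) :
    Real.log (posteriorMass V ρ (z + u)) + κ / (κ + ρ ^ 2) / 2 * ‖u‖ ^ 2 ≤
      Real.log (posteriorMass V ρ z) + (-⟪z, u⟫ + ρ * ⟪posteriorMean V ρ z, u⟫) := by
  have hpos := posteriorMass_pos hV hi ρ
  have hder : HasDerivAt (fun s : ℝ => Real.log (posteriorMass V ρ (z + s • u)) +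
      κ / (κ + ρ ^ 2) / 2 * ‖u‖ ^ 2 * s ^ 2) (-⟪z, u⟫ + ρ * ⟪posteriorMean V ρ z, u⟫) 0 := by
    refine (((hasDerivAt_posteriorMass_line hV hi hi1 ρ z u).log (hpos _).ne').fun_add
      ((hasDerivAt_pow 2 0).const_mul (κ / (κ + ρ ^ 2) / 2 * ‖u‖ ^ 2))).congr_deriv ?_
    simp only [zero_smul, add_zero, posteriorMean, real_inner_smul_left]
    field_simp [(hpos z).ne']
    simp
  have := le_add_deriv_of_midpoint_concave (fun s => ?_) hder
  · simpa using this
  · have h := Real.log_le_log (mul_pos (hpos _) (hpos _))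
      (posteriorMass_mul_le hκ hV hi hmid ρ (z + (0 : ℝ) • u) (z + s • u))
    have h2 : (2 : ℝ)⁻¹ • (z + (0 : ℝ) • u + (z + s • u)) = z + (s / 2) • u := by module
    have h3 : z + (0 : ℝ) • u - (z + s • u) = (-s) • u := by module
    rw [h2, h3, Real.log_mul (hpos _).ne' (hpos _).ne', Real.log_pow,
      Real.log_mul (Real.exp_pos _).ne' (hpos _).ne', Real.log_exp, norm_smul, mul_pow,
      Real.norm_eq_abs, sq_abs] at h
    push_cast at h
    nlinarith

/-- The covariance bound for strongly log-concave posteriors, in integrated form. -/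
theorem inner_posteriorMean_sub_le (hκ : 0 < κ) (hV : Continuous V)
    (hi : Integrable fun y => Real.exp (-V y)) (hi1 : Integrable fun y => ‖y‖ * Real.exp (-V y))
    (hmid : ∀ x y, 2 * V ((2 : ℝ)⁻¹ • (x + y)) ≤ V x + V y - κ / 4 * ‖x - y‖ ^ 2)
    {ρ : ℝ} (hρ : 0 < ρ) (z z' : EuclideanSpace ℝ (Fin d)) :
    ⟪posteriorMean V ρ z - posteriorMean V ρ z', z - z'⟫ ≤ ρ / (κ + ρ ^ 2) * ‖z - z'‖ ^ 2 := by
  have h1 := inner_posteriorMean_tangent hκ hV hi hi1 hmid ρ z (z' - z)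
  have h2 := inner_posteriorMean_tangent hκ hV hi hi1 hmid ρ z' (z - z')
  rw [add_sub_cancel, norm_sub_rev, ← neg_sub z z', inner_neg_right, inner_neg_right] at h1
  rw [add_sub_cancel] at h2
  have h3 : ⟪z, z - z'⟫ - ⟪z', z - z'⟫ = ‖z - z'‖ ^ 2 := by
    rw [← inner_sub_left, real_inner_self_eq_norm_sq]
  rw [inner_sub_left]
  have h4 : ρ * (⟪posteriorMean V ρ z, z - z'⟫ - ⟪posteriorMean V ρ z', z - z'⟫) ≤
      ρ * (ρ / (κ + ρ ^ 2) * ‖z - z'‖ ^ 2) := by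
    have h5 : ρ * (ρ / (κ + ρ ^ 2) * ‖z - z'‖ ^ 2) =
        ‖z - z'‖ ^ 2 - κ / (κ + ρ ^ 2) * ‖z - z'‖ ^ 2 := by
      field_simp
      ring
    rw [h5]
    linarith
  exact le_of_mul_le_mul_left h4 hρ

/-- Near a compact set of parameters, the posterior mean agrees with a globally bounded, globally
Lipschitz field. -/
theorem exists_lipschitz_eqOn_posteriorMean (hV : Continuous V)
    (hi : Integrable fun y => Real.exp (-V y)) (hi1 : Integrable fun y => ‖y‖ * Real.exp (-V y))
    {S : Set (ℝ × EuclideanSpace ℝ (Fin d))} (hS : IsCompact S) :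
    ∃ (F : ℝ → EuclideanSpace ℝ (Fin d) → EuclideanSpace ℝ (Fin d)) (K L : ℝ≥0),
      (∀ z, Continuous fun ρ => F ρ z) ∧ (∀ ρ, LipschitzWith K (F ρ)) ∧ (∀ ρ z, ‖F ρ z‖ ≤ L) ∧
        ∀ p ∈ S, F p.1 p.2 = posteriorMean V p.1 p.2 := by
  obtain ⟨c, hc, hcS⟩ : ∃ c > 0, ∀ p ∈ S, c ≤ posteriorMass V p.1 p.2 := by
    rcases S.eq_empty_or_nonempty with rfl | hne
    · exact ⟨1, one_pos, by simp⟩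
    · obtain ⟨p, -, hp⟩ := hS.exists_isMinOn hne (continuous_posteriorMass hV hi).continuousOn
      exact ⟨_, posteriorMass_pos hV hi p.1 p.2, fun q hq => hp hq⟩
  obtain ⟨A, hA_eq⟩ : ∃ A, A = ∫ y, Real.exp (-V y) := ⟨_, rfl⟩
  obtain ⟨B, hB_eq⟩ : ∃ B, B = ∫ y, ‖y‖ * Real.exp (-V y) := ⟨_, rfl⟩
  have hA : 0 ≤ A := by rw [hA_eq]; positivity
  have hB : 0 ≤ B := by rw [hB_eq]; positivity
  have hmax : ∀ ρ z, 0 < max (posteriorMass V ρ z) c := fun ρ z => lt_max_of_lt_right hc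
  have hinv : ∀ ρ z, (max (posteriorMass V ρ z) c)⁻¹ ≤ c⁻¹ := fun ρ z =>
    inv_anti₀ hc (le_max_right _ _)
  have hinv0 : ∀ ρ z, 0 ≤ (max (posteriorMass V ρ z) c)⁻¹ := fun ρ z => (inv_pos.2 (hmax ρ z)).le
  refine ⟨fun ρ z => (max (posteriorMass V ρ z) c)⁻¹ • posteriorMoment V ρ z,
    .mk (c⁻¹ * B + c⁻¹ * c⁻¹ * A * B) (by positivity), .mk (c⁻¹ * B) (by positivity),
    fun z => ?_, fun ρ => ?_,
    fun ρ z => ?_, fun p hp => ?_⟩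
  · exact (((continuous_posteriorMass hV hi).uncurry_right z |>.max continuous_const).inv₀
      fun ρ => (hmax ρ z).ne').smul ((continuous_posteriorMoment hV hi1).uncurry_right z)
  · refine LipschitzWith.of_dist_le_mul fun z z' => ?_
    rw [dist_eq_norm, dist_eq_norm, NNReal.coe_mk]
    calc _ ≤ c⁻¹ * ‖posteriorMoment V ρ z - posteriorMoment V ρ z'‖ +
            c⁻¹ * c⁻¹ * |posteriorMass V ρ z - posteriorMass V ρ z'| * ‖posteriorMoment V ρ z'‖ :=
          norm_inv_max_smul_sub_le hc _ _ _ _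
      _ ≤ c⁻¹ * (B * ‖z - z'‖) + c⁻¹ * c⁻¹ * (A * ‖z - z'‖) * B :=
          add_le_add
            (mul_le_mul_of_nonneg_left (hB_eq ▸ norm_posteriorMoment_sub_le hV hi1 ρ z z')
              (by positivity))
            (mul_le_mul
              (mul_le_mul_of_nonneg_left (hA_eq ▸ abs_posteriorMass_sub_le hV hi ρ z z')
                (by positivity))
              (hB_eq ▸ norm_posteriorMoment_le hi1 ρ z') (norm_nonneg _) (by positivity))
      _ = _ := by ring
  · rw [norm_smul, Real.norm_of_nonneg (hinv0 _ _), NNReal.coe_mk]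
    exact mul_le_mul (hinv ρ z) (hB_eq ▸ norm_posteriorMoment_le hi1 ρ z) (norm_nonneg _)
      (by positivity)
  · simp only [posteriorMean, max_eq_left (hcS p hp)]

end Posterior

section TimeChange

variable {E : Type*} [NormedAddCommGroup E] [InnerProductSpace ℝ E]

theorem exists_hasDerivAt_of_lipschitz_of_bounded [CompleteSpace E] {F : ℝ → E → E} {K L : ℝ≥0}
    (hF : ∀ z, Continuous fun ρ => F ρ z) (hK : ∀ ρ, LipschitzWith K (F ρ))
    (hL : ∀ ρ z, ‖F ρ z‖ ≤ L) {b : ℝ} (hb : 0 ≤ b) (x : E) :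
    ∃ g : ℝ → E, g 0 = x ∧ ∀ ρ ∈ Ioo (-1) b, HasDerivAt g (F ρ (g ρ)) ρ := by
  have hpl : IsPicardLindelof F (tmin := -1) (tmax := b) ⟨0, by simp [hb]⟩ x
      (L * (max b 1).toNNReal) 0 L K :=
    { lipschitzOnWith := fun ρ _ => (hK ρ).lipschitzOnWith
      continuousOn := fun z _ => (hF z).continuousOn
      norm_le := fun ρ _ z _ => hL ρ z
      mul_max_le := by simp }
  obtain ⟨g, hg0, hg⟩ := hpl.exists_eq_forall_mem_Icc_hasDerivWithinAt₀
  exact ⟨g, hg0, fun ρ hρ => (hg ρ (Ioo_subset_Icc_self hρ)).hasDerivAt (Icc_mem_nhds hρ.1 hρ.2)⟩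

theorem eq_zero_of_deriv_le_mul {u u' : ℝ → ℝ} {C T : ℝ} (hu0 : u 0 = 0) (hu : ∀ t, 0 ≤ u t)
    (hc : ContinuousOn u (Icc 0 T)) (hd : ∀ t ∈ Ioo 0 T, HasDerivAt u (u' t) t)
    (hle : ∀ t ∈ Ioo 0 T, u' t ≤ C * u t) : ∀ t ∈ Icc 0 T, u t = 0 := by
  have hder : ∀ t ∈ Ioo 0 T, HasDerivAt (fun t => Real.exp (-C * t) * u t)
      (Real.exp (-C * t) * (u' t - C * u t)) t := fun t ht => by
    refine (((hasDerivAt_id t).const_mul (-C)).exp.fun_mul (hd t ht)).congr_deriv ?_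
    simp only [id]
    ring
  have hanti : AntitoneOn (fun t => Real.exp (-C * t) * u t) (Icc 0 T) := by
    refine antitoneOn_of_deriv_nonpos (convex_Icc 0 T) (by fun_prop) ?_ ?_ <;>
      rw [interior_Icc]
    · exact fun t ht => (hder t ht).differentiableAt.differentiableWithinAt
    · intro t ht
      rw [(hder t ht).deriv]
      exact mul_nonpos_of_nonneg_of_nonpos (Real.exp_pos _).le (by linarith [hle t ht])
  intro t ht
  have := hanti (left_mem_Icc.2 (ht.1.trans ht.2)) ht ht.1
  simp only [hu0, mul_zero] at this
  exact le_antisymm (by nlinarith [Real.exp_pos (-C * t)]) (hu t)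

/-- Solutions of a time-changed ODE are time changes of solutions. -/
theorem eq_comp_of_hasDerivAt_time_change {F : ℝ → E → E} {K : ℝ≥0}
    (hK : ∀ ρ, LipschitzWith K (F ρ)) {g h : ℝ → E} {r r' : ℝ → ℝ} {C T : ℝ} (h0 : h 0 = g (r 0))
    (hr : ContinuousOn r (Icc 0 T)) (hr' : ∀ t ∈ Ioo 0 T, HasDerivAt r (r' t) t)
    (hC : ∀ t ∈ Ioo 0 T, |r' t| ≤ C) (hh : ContinuousOn h (Icc 0 T))
    (hh' : ∀ t ∈ Ioo 0 T, HasDerivAt h (r' t • F (r t) (h t)) t)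
    (hg : ∀ t ∈ Icc 0 T, HasDerivAt g (F (r t) (g (r t))) (r t)) :
    ∀ t ∈ Icc 0 T, h t = g (r t) := by
  have hgr : ContinuousOn (fun t => g (r t)) (Icc 0 T) := fun t ht =>
    (hg t ht).continuousAt.comp_continuousWithinAt (hr t ht)
  have key := eq_zero_of_deriv_le_mul (u := fun t => ‖h t - g (r t)‖ ^ 2) (T := T) (C := 2 * C * K)
    (u' := fun t => 2 * ⟪h t - g (r t), r' t • F (r t) (h t) - r' t • F (r t) (g (r t))⟫)
    (by simp [h0]) (fun t => by positivity) ((hh.sub hgr).norm.pow 2)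
    (fun t ht => ((hh' t ht).sub
      ((hg t (Ioo_subset_Icc_self ht)).scomp t (hr' t ht))).norm_sq)
    (fun t ht => by
      have h1 := real_inner_le_norm (h t - g (r t))
        (r' t • F (r t) (h t) - r' t • F (r t) (g (r t)))
      have h2 : ‖r' t • F (r t) (h t) - r' t • F (r t) (g (r t))‖ ≤ C * (K * ‖h t - g (r t)‖) := by
        rw [← smul_sub, norm_smul]
        gcongr
        · exact (abs_nonneg _).trans (hC t ht)
        · exact hC t ht
        · exact (hK (r t)).norm_sub_le _ _
      nlinarith [mul_le_mul_of_nonneg_left h2 (norm_nonneg (h t - g (r t)))])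
  intro t ht
  have := key t ht
  rwa [sq_eq_zero_iff, norm_eq_zero, sub_eq_zero] at this

/-- Growth bound for a flow driven by `r' • w (r, ·)` where `w` satisfies a one-sided Lipschitz
bound; the clock `r` need not be monotone. -/
theorem norm_sub_sq_le_of_time_change [CompleteSpace E] {w : ℝ → E → E} {κ : ℝ} (hκ : 0 < κ)
    (hw : ∀ ρ > 0, ∀ z z', ⟪w ρ z - w ρ z', z - z'⟫ ≤ ρ / (κ + ρ ^ 2) * ‖z - z'‖ ^ 2)
    (hloc : ∀ S : Set (ℝ × E), IsCompact S → ∃ (F : ℝ → E → E) (K L : ℝ≥0),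
      (∀ z, Continuous fun ρ => F ρ z) ∧ (∀ ρ, LipschitzWith K (F ρ)) ∧ (∀ ρ z, ‖F ρ z‖ ≤ L) ∧
        ∀ p ∈ S, F p.1 p.2 = w p.1 p.2)
    {r r' : ℝ → ℝ} {C T : ℝ} (hT : 0 ≤ T) (hr : ContinuousOn r (Icc 0 T)) (hr0 : r 0 = 0)
    (hrpos : ∀ t ∈ Icc 0 T, 0 ≤ r t) (hr' : ∀ t ∈ Ioo 0 T, HasDerivAt r (r' t) t)
    (hC : ∀ t ∈ Ioo 0 T, |r' t| ≤ C) {h₁ h₂ : ℝ → E} (hh₁ : ContinuousOn h₁ (Icc 0 T))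
    (hh₂ : ContinuousOn h₂ (Icc 0 T))
    (hh₁' : ∀ t ∈ Ioo 0 T, HasDerivAt h₁ (r' t • w (r t) (h₁ t)) t)
    (hh₂' : ∀ t ∈ Ioo 0 T, HasDerivAt h₂ (r' t • w (r t) (h₂ t)) t) :
    ‖h₁ T - h₂ T‖ ^ 2 ≤ (1 + r T ^ 2 / κ) * ‖h₁ 0 - h₂ 0‖ ^ 2 := by
  obtain ⟨F, K, L, hFc, hK, hL, hFw⟩ := hloc
    ((fun t => (r t, h₁ t)) '' Icc 0 T ∪ (fun t => (r t, h₂ t)) '' Icc 0 T)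
    ((isCompact_Icc.image_of_continuousOn (hr.prodMk hh₁)).union
      (isCompact_Icc.image_of_continuousOn (hr.prodMk hh₂)))
  have hF₁ : ∀ t ∈ Icc 0 T, F (r t) (h₁ t) = w (r t) (h₁ t) := fun t ht =>
    hFw (r t, h₁ t) (.inl (mem_image_of_mem _ ht))
  have hF₂ : ∀ t ∈ Icc 0 T, F (r t) (h₂ t) = w (r t) (h₂ t) := fun t ht =>
    hFw (r t, h₂ t) (.inr (mem_image_of_mem _ ht))
  obtain ⟨R, hR⟩ := (isCompact_Icc.image_of_continuousOn hr).bddAbove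
  have hrR : ∀ t ∈ Icc 0 T, r t ≤ R := fun t ht => hR (mem_image_of_mem _ ht)
  have h0T : (0 : ℝ) ∈ Icc 0 T := left_mem_Icc.2 hT
  have hTT : T ∈ Icc 0 T := right_mem_Icc.2 hT
  have hR0 : 0 ≤ R := hr0 ▸ hrR 0 h0T
  obtain ⟨g₁, hg₁0, hg₁⟩ := exists_hasDerivAt_of_lipschitz_of_bounded hFc hK hL
    (show 0 ≤ R + 1 by linarith) (h₁ 0)
  obtain ⟨g₂, hg₂0, hg₂⟩ := exists_hasDerivAt_of_lipschitz_of_bounded hFc hK hL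
    (show 0 ≤ R + 1 by linarith) (h₂ 0)
  have hmem : ∀ t ∈ Icc 0 T, r t ∈ Ioo (-1) (R + 1) := fun t ht =>
    ⟨by linarith [hrpos t ht], by linarith [hrR t ht]⟩
  have heq₁ := eq_comp_of_hasDerivAt_time_change hK (by rw [hr0, hg₁0]) hr hr' hC hh₁
    (fun t ht => by rw [hF₁ t (Ioo_subset_Icc_self ht)]; exact hh₁' t ht)
    fun t ht => hg₁ _ (hmem t ht)
  have heq₂ := eq_comp_of_hasDerivAt_time_change hK (by rw [hr0, hg₂0]) hr hr' hC hh₂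
    (fun t ht => by rw [hF₂ t (Ioo_subset_Icc_self ht)]; exact hh₂' t ht)
    fun t ht => hg₂ _ (hmem t ht)
  have hsub : Icc 0 (r T) ⊆ Ioo (-1) (R + 1) := fun ρ hρ =>
    ⟨by linarith [hρ.1], by linarith [hρ.2, hrR T hTT]⟩
  have hQ : ∀ ρ ∈ Icc 0 (r T), HasDerivAt (fun ρ => ‖g₁ ρ - g₂ ρ‖ ^ 2 / (κ + ρ ^ 2))
      ((2 * ⟪g₁ ρ - g₂ ρ, F ρ (g₁ ρ) - F ρ (g₂ ρ)⟫ * (κ + ρ ^ 2) -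
        ‖g₁ ρ - g₂ ρ‖ ^ 2 * (2 * ρ)) / (κ + ρ ^ 2) ^ 2) ρ := fun ρ hρ => by
    refine (((hg₁ ρ (hsub hρ)).fun_sub (hg₂ ρ (hsub hρ))).norm_sq.fun_div
      ((hasDerivAt_pow 2 ρ).const_add κ) (by positivity)).congr_deriv ?_
    simp
  have hanti : AntitoneOn (fun ρ => ‖g₁ ρ - g₂ ρ‖ ^ 2 / (κ + ρ ^ 2)) (Icc 0 (r T)) := by
    refine antitoneOn_of_deriv_nonpos (convex_Icc _ _)
      (fun ρ hρ => (hQ ρ hρ).continuousAt.continuousWithinAt)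
      (fun ρ hρ => (hQ ρ (interior_subset hρ)).differentiableAt.differentiableWithinAt)
      fun ρ hρ => ?_
    have hρ' := interior_subset hρ
    rw [interior_Icc] at hρ
    rw [(hQ ρ hρ').deriv]
    obtain ⟨s, hs, rfl⟩ := intermediate_value_Icc hT hr (by rwa [hr0])
    rw [← heq₁ s hs, ← heq₂ s hs, hF₁ s hs, hF₂ s hs, real_inner_comm]
    have h := hw (r s) hρ.1 (h₁ s) (h₂ s)
    have hpos : 0 < κ + r s ^ 2 := by positivity
    rw [div_mul_eq_mul_div, le_div_iff₀ hpos] at h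
    exact div_nonpos_of_nonpos_of_nonneg (by linarith) (by positivity)
  have hrT := hrpos T hTT
  have := hanti (left_mem_Icc.2 hrT) (right_mem_Icc.2 hrT) hrT
  simp only [hg₁0, hg₂0, ← heq₁ T hTT, ← heq₂ T hTT] at this
  rw [div_le_div_iff₀ (by positivity) (by positivity)] at this
  rw [one_add_div hκ.ne', div_mul_eq_mul_div, le_div_iff₀ hκ]
  nlinarith

end TimeChange

theorem interpolant_velocity_eq {d : ℕ} {V : EuclideanSpace ℝ (Fin d) → ℝ} (hV : Continuous V)
    (hi : Integrable fun y => Real.exp (-V y)) (hi1 : Integrable fun y => ‖y‖ * Real.exp (-V y))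
    {a b : ℝ} (ha : 0 < a) (a' b' : ℝ) (x : EuclideanSpace ℝ (Fin d)) :
    (∫ y, Real.exp (-V y - ‖x - b • y‖ ^ 2 / (2 * a ^ 2)))⁻¹ •
        ∫ y, Real.exp (-V y - ‖x - b • y‖ ^ 2 / (2 * a ^ 2)) • ((a' / a) • (x - b • y) + b' • y) =
      (a' / a) • x + (b' - a' / a * b) • posteriorMean V (b / a) (a⁻¹ • x) := by
  have hweight : ∀ y, Real.exp (-V y - ‖x - b • y‖ ^ 2 / (2 * a ^ 2)) =
      posteriorWeight V (b / a) (a⁻¹ • x) y := fun y => by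
    have : a⁻¹ • x - (b / a) • y = a⁻¹ • (x - b • y) := by
      rw [smul_sub, smul_smul, inv_mul_eq_div]
    rw [posteriorWeight, this, norm_smul, norm_inv, Real.norm_of_nonneg ha.le]
    congr 2
    field_simp
  have hsplit : ∀ y, posteriorWeight V (b / a) (a⁻¹ • x) y • ((a' / a) • (x - b • y) + b' • y) =
      posteriorWeight V (b / a) (a⁻¹ • x) y • ((a' / a) • x) +
        (b' - a' / a * b) • (posteriorWeight V (b / a) (a⁻¹ • x) y • y) := fun y => by module
  simp only [hweight, hsplit]
  rw [integral_add ((integrable_posteriorWeight hV hi _ _).smul_const _)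
    ((integrable_posteriorWeight_smul hV hi1 _ _).fun_smul _), integral_smul_const, integral_smul,
    smul_add, ← posteriorMass, ← posteriorMoment,
    inv_smul_smul₀ (posteriorMass_pos hV hi _ _).ne', smul_comm, posteriorMean]

/-- Growth bound between two trajectories of the interpolant, in terms of the explicit form of the
velocity. -/
theorem norm_flow_sub_le {d : ℕ} {V : EuclideanSpace ℝ (Fin d) → ℝ} {κ : ℝ} (hκ : 0 < κ)
    (hV : Continuous V) (hi : Integrable fun y => Real.exp (-V y))
    (hi1 : Integrable fun y => ‖y‖ * Real.exp (-V y))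
    (hmid : ∀ x y, 2 * V ((2 : ℝ)⁻¹ • (x + y)) ≤ V x + V y - κ / 4 * ‖x - y‖ ^ 2)
    {α β : ℝ → ℝ} (hα : ContDiff ℝ 1 α) (hβ : ContDiff ℝ 1 β) (hα0 : α 0 = 1) (hβ0 : β 0 = 0)
    {T : ℝ} (hT : 0 ≤ T) (hαpos : ∀ t ∈ Icc 0 T, 0 < α t) (hβpos : ∀ t ∈ Icc 0 T, 0 ≤ β t)
    {f₁ f₂ : ℝ → EuclideanSpace ℝ (Fin d)} (hf₁ : ContinuousOn f₁ (Icc 0 T))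
    (hf₂ : ContinuousOn f₂ (Icc 0 T))
    (hf₁' : ∀ t ∈ Ioo 0 T, HasDerivAt f₁ ((deriv α t / α t) • f₁ t +
      (deriv β t - deriv α t / α t * β t) • posteriorMean V (β t / α t) ((α t)⁻¹ • f₁ t)) t)
    (hf₂' : ∀ t ∈ Ioo 0 T, HasDerivAt f₂ ((deriv α t / α t) • f₂ t +
      (deriv β t - deriv α t / α t * β t) • posteriorMean V (β t / α t) ((α t)⁻¹ • f₂ t)) t) :
    ‖f₁ T - f₂ T‖ ≤ √(α T ^ 2 + β T ^ 2 / κ) * ‖f₁ 0 - f₂ 0‖ := by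
  have hα' : ∀ t, HasDerivAt α (deriv α t) t := fun t =>
    (hα.differentiable one_ne_zero t).hasDerivAt
  have hβ' : ∀ t, HasDerivAt β (deriv β t) t := fun t =>
    (hβ.differentiable one_ne_zero t).hasDerivAt
  have hαc := hα.continuous
  have hβc := hβ.continuous
  have hαc' := hα.continuous_deriv le_rfl
  have hβc' := hβ.continuous_deriv le_rfl
  have hne : ∀ t ∈ Icc 0 T, α t ≠ 0 := fun t ht => (hαpos t ht).ne'
  have hne2 : ∀ t ∈ Icc 0 T, α t ^ 2 ≠ 0 := fun t ht => pow_ne_zero 2 (hne t ht)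
  have hrc : ContinuousOn (fun t => (deriv β t * α t - β t * deriv α t) / α t ^ 2) (Icc 0 T) := by
    fun_prop (disch := assumption)
  obtain ⟨C, hC⟩ := isCompact_Icc.exists_bound_of_continuousOn hrc
  have hscale : ∀ f : ℝ → EuclideanSpace ℝ (Fin d), (∀ t ∈ Ioo 0 T, HasDerivAt f
      ((deriv α t / α t) • f t + (deriv β t - deriv α t / α t * β t) •
        posteriorMean V (β t / α t) ((α t)⁻¹ • f t)) t) →
      ∀ t ∈ Ioo 0 T, HasDerivAt (fun t => (α t)⁻¹ • f t)
        (((deriv β t * α t - β t * deriv α t) / α t ^ 2) •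
          posteriorMean V (β t / α t) ((α t)⁻¹ • f t)) t := fun f hf t ht => by
    have h0 := hne t (Ioo_subset_Icc_self ht)
    refine (((hα' t).fun_inv h0).fun_smul (hf t ht)).congr_deriv ?_
    rw [smul_add, smul_smul, smul_smul, add_right_comm, ← add_smul]
    have h1 : (α t)⁻¹ * (deriv α t / α t) + -deriv α t / α t ^ 2 = 0 := by field_simp; ring
    have h2 : (α t)⁻¹ * (deriv β t - deriv α t / α t * β t) =
        (deriv β t * α t - β t * deriv α t) / α t ^ 2 := by field_simp
    rw [h1, h2, zero_smul, zero_add]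
  have hTT : T ∈ Icc 0 T := right_mem_Icc.2 hT
  have hαT := hαpos T hTT
  have key := norm_sub_sq_le_of_time_change (w := posteriorMean V) hκ
    (fun ρ hρ z z' => inner_posteriorMean_sub_le hκ hV hi hi1 hmid hρ z z')
    (fun S hS => exists_lipschitz_eqOn_posteriorMean hV hi hi1 hS)
    (r := fun t => β t / α t) (C := C) hT (by fun_prop (disch := assumption))
    (by simp [hβ0]) (fun t ht => div_nonneg (hβpos t ht) (hαpos t ht).le)
    (fun t ht => (hβ' t).fun_div (hα' t) (hne t (Ioo_subset_Icc_self ht)))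
    (fun t ht => hC t (Ioo_subset_Icc_self ht))
    (h₁ := fun t => (α t)⁻¹ • f₁ t) (h₂ := fun t => (α t)⁻¹ • f₂ t)
    ((hαc.continuousOn.inv₀ hne).smul hf₁) ((hαc.continuousOn.inv₀ hne).smul hf₂)
    (hscale f₁ hf₁') (hscale f₂ hf₂')
  simp only [hα0, inv_one, one_smul, ← smul_sub, norm_smul, norm_inv,
    Real.norm_of_nonneg hαT.le] at key
  refine le_of_sq_le_sq ?_ (by positivity)
  rw [mul_pow, Real.sq_sqrt (by positivity)]
  calc ‖f₁ T - f₂ T‖ ^ 2 = α T ^ 2 * ((α T)⁻¹ * ‖f₁ T - f₂ T‖) ^ 2 := by field_simp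
    _ ≤ α T ^ 2 * ((1 + (β T / α T) ^ 2 / κ) * ‖f₁ 0 - f₂ 0‖ ^ 2) := by gcongr
    _ = _ := by field_simp

/-- With standard Gaussian base `μ₀ = N(0, I_d)` and `κ`-strongly-log-concave
target `μ₁ = e^{-V₁}` (`κ > 0`), the flow map `f^v_t` of the isotropic stochastic interpolant
satisfies `‖D f^v_t(x)‖_op ≤ √(α_t² + β_t²/κ)` for all `t ∈ [0,1]`; in particular the
time-one map `f^v_1` is `(1/√κ)`-Lipschitz. -/
theorem stochastic_interpolant_flow_lipschitz
    (d : ℕ) (κ : ℝ) (hκ : 0 < κ)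
    (V₁ : Euc d → ℝ) (hV₁ : ContDiff ℝ 2 V₁)
    (hμ₁ : (∫ y : Euc d, Real.exp (-V₁ y)) = 1)
    (hlc : ∀ x w : Euc d, κ * ‖w‖ ^ 2 ≤ iteratedFDeriv ℝ 2 V₁ x ![w, w])
    (α β : ℝ → ℝ) (hα : ContDiff ℝ 2 α) (hβ : ContDiff ℝ 2 β)
    (hα0 : α 0 = 1) (hα1 : α 1 = 0) (hβ0 : β 0 = 0) (hβ1 : β 1 = 1)
    (hαpos : ∀ t ∈ Ioo (0:ℝ) 1, 0 < α t) (hβpos : ∀ t ∈ Ioo (0:ℝ) 1, 0 < β t)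
    (v : ℝ → Euc d → Euc d)
    -- `v t x = E[α̇_t X₀ + β̇_t X₁ | α_t X₀ + β_t X₁ = x]`, realized via the regular
    -- conditional density of `X₁` given `X_t = x`:
    (hv : ∀ t ∈ Ioo (0:ℝ) 1, ∀ x : Euc d, v t x =
      (∫ y : Euc d, Real.exp (-V₁ y - ‖x - β t • y‖ ^ 2 / (2 * (α t) ^ 2)))⁻¹ •
        ∫ y : Euc d, Real.exp (-V₁ y - ‖x - β t • y‖ ^ 2 / (2 * (α t) ^ 2)) •
          ((deriv α t / α t) • (x - β t • y) + deriv β t • y))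
    (f : ℝ → Euc d → Euc d)
    (hf0 : ∀ x : Euc d, f 0 x = x)
    (hfc : ∀ x : Euc d, ContinuousOn (fun s => f s x) (Icc (0:ℝ) 1))
    (hflow : ∀ x : Euc d, ∀ t ∈ Ioo (0:ℝ) 1, HasDerivAt (fun s => f s x) (v t (f t x)) t) :
    (∀ t ∈ Icc (0:ℝ) 1, ∀ x : Euc d,
        ‖fderiv ℝ (f t) x‖ ≤ Real.sqrt ((α t) ^ 2 + (β t) ^ 2 / κ)) ∧
      LipschitzWith (Real.toNNReal (1 / Real.sqrt κ)) (f 1) := by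
  have hi : Integrable fun y => Real.exp (-V₁ y) :=
    not_imp_comm.1 integral_undef (by rw [hμ₁]; exact one_ne_zero)
  have hi1 := integrable_norm_mul_exp_neg hκ hV₁ hlc
  have hα' : ∀ t ∈ Ico (0 : ℝ) 1, 0 < α t := fun t ht => by
    rcases ht.1.eq_or_lt with rfl | h
    · rw [hα0]; exact one_pos
    · exact hαpos t ⟨h, ht.2⟩
  have hβ' : ∀ t ∈ Ico (0 : ℝ) 1, 0 ≤ β t := fun t ht => by
    rcases ht.1.eq_or_lt with rfl | h
    · exact hβ0.ge
    · exact (hβpos t ⟨h, ht.2⟩).le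
  have hαc := hα.continuous
  have hβc := hβ.continuous
  have hderiv : ∀ x, ∀ t ∈ Ioo (0 : ℝ) 1, HasDerivAt (fun s => f s x)
      ((deriv α t / α t) • f t x + (deriv β t - deriv α t / α t * β t) •
        posteriorMean V₁ (β t / α t) ((α t)⁻¹ • f t x)) t := fun x t ht => by
    rw [← interpolant_velocity_eq hV₁.continuous hi hi1 (hαpos t ht), ← hv t ht]
    exact hflow x t ht
  have hIoo : ∀ T ∈ Ioo (0 : ℝ) 1, ∀ x y,
      ‖f T x - f T y‖ ≤ √(α T ^ 2 + β T ^ 2 / κ) * ‖x - y‖ := fun T hT x y => by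
    have hsub : Icc 0 T ⊆ Ico 0 1 := fun t ht => ⟨ht.1, ht.2.trans_lt hT.2⟩
    have hsub' : Icc 0 T ⊆ Icc 0 1 := hsub.trans Ico_subset_Icc_self
    have := norm_flow_sub_le hκ hV₁.continuous hi hi1 (add_le_sub_sq_of_hessian hV₁ hlc)
      (hα.of_le one_le_two) (hβ.of_le one_le_two) hα0 hβ0 hT.1.le (fun t ht => hα' t (hsub ht))
      (fun t ht => hβ' t (hsub ht)) ((hfc x).mono hsub') ((hfc y).mono hsub')
      (fun t ht => hderiv x t ⟨ht.1, ht.2.trans hT.2⟩)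
      (fun t ht => hderiv y t ⟨ht.1, ht.2.trans hT.2⟩)
    rwa [hf0, hf0] at this
  have hIcc : ∀ T ∈ Icc (0 : ℝ) 1, ∀ x y,
      ‖f T x - f T y‖ ≤ √(α T ^ 2 + β T ^ 2 / κ) * ‖x - y‖ := fun T hT x y => by
    refine ContinuousWithinAt.closure_le (s := Ioo 0 1) (f := fun T => ‖f T x - f T y‖)
      (g := fun T => √(α T ^ 2 + β T ^ 2 / κ) * ‖x - y‖) (by rwa [closure_Ioo zero_ne_one]) ?_
      (by fun_prop) fun t ht => hIoo t ht x y
    exact (((hfc x).sub (hfc y)).norm T hT).mono Ioo_subset_Icc_self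
  have hlip : ∀ T ∈ Icc (0 : ℝ) 1,
      LipschitzWith (√(α T ^ 2 + β T ^ 2 / κ)).toNNReal (f T) := fun T hT =>
    LipschitzWith.of_dist_le_mul fun x y => by
      rw [dist_eq_norm, dist_eq_norm, Real.coe_toNNReal _ (Real.sqrt_nonneg _)]
      exact hIcc T hT x y
  refine ⟨fun t ht x => ?_, ?_⟩
  · have := norm_fderiv_le_of_lipschitz ℝ (x₀ := x) (hlip t ht)
    rwa [Real.coe_toNNReal _ (Real.sqrt_nonneg _)] at this
  · have := hlip 1 (right_mem_Icc.2 zero_le_one)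
    simpa [hα1, hβ1] using this
end
end

section
/- Let μ0 = N(0, I_d) and let μ1(x) = e^{-V_1(x)} be a probability density with V_1 ∈ C²(ℝ^d). Let v_t be the velocity field of the isotropic stochastic interpolant with coefficients (α_t), (β_t). Then for every t ∈ (0,1) and every x ∈ ℝ^d, the following Tweedie-type identity holds: v_t(x) = (α̇_t/α_t) x + (β̇_t − α̇_t β_t/α_t)(α_t²/β_t) ∇b_t(x). -/
open MeasureTheory Real Set
open scoped RealInnerProductSpace

noncomputable section

/-- Completing the square for an exponent with a linear factor `‖y‖`, uniformly over `x` in a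
ball of radius `R`. -/
theorem one_add_norm_mul_exp_le {E : Type*} [NormedAddCommGroup E] [InnerProductSpace ℝ E]
    {a k R : ℝ} (ha : 0 < a) (hk : 0 ≤ k) (u : ℝ) {x : E} (hx : ‖x‖ ≤ R) (y : E) :
    (1 + ‖y‖) * exp (-u - a * ‖y‖ ^ 2 + k * ⟪y, x⟫) ≤
      exp ((k * R + 1) ^ 2 / (4 * a)) * exp (-u) := by
  have h1 : 1 + ‖y‖ ≤ exp ‖y‖ := by linarith [add_one_le_exp ‖y‖]
  have h2 : k * ⟪y, x⟫ ≤ k * (‖y‖ * R) :=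
    mul_le_mul_of_nonneg_left
      ((real_inner_le_norm y x).trans (mul_le_mul_of_nonneg_left hx (norm_nonneg y))) hk
  have h3 : (k * R + 1) ^ 2 / (4 * a) - (k * R + 1) * ‖y‖ + a * ‖y‖ ^ 2
      = (2 * a * ‖y‖ - (k * R + 1)) ^ 2 / (4 * a) := by
    field_simp
    ring
  have h4 : 0 ≤ (2 * a * ‖y‖ - (k * R + 1)) ^ 2 / (4 * a) := by positivity
  calc (1 + ‖y‖) * exp (-u - a * ‖y‖ ^ 2 + k * ⟪y, x⟫)
      ≤ exp ‖y‖ * exp (-u - a * ‖y‖ ^ 2 + k * ⟪y, x⟫) := by gcongr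
    _ ≤ exp ((k * R + 1) ^ 2 / (4 * a)) * exp (-u) := by
      rw [← exp_add, ← exp_add, exp_le_exp]
      nlinarith

section

variable {d : ℕ} {V : Euc d → ℝ} {a k : ℝ}

theorem integrable_exp_tilt (hV : Continuous V) (hint : Integrable fun y => exp (-V y))
    (ha : 0 < a) (hk : 0 ≤ k) (x : Euc d) :
    Integrable fun y => exp (-V y - a * ‖y‖ ^ 2 + k * ⟪y, x⟫) := by
  refine (hint.const_mul (exp ((k * ‖x‖ + 1) ^ 2 / (4 * a)))).mono'
    (by fun_prop) (.of_forall fun y => ?_)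
  rw [norm_of_nonneg (exp_pos _).le]
  refine le_trans ?_ (one_add_norm_mul_exp_le ha hk (V y) le_rfl y)
  exact le_mul_of_one_le_left (exp_pos _).le (by linarith [norm_nonneg y])

theorem integrable_exp_tilt_smul (hV : Continuous V) (hint : Integrable fun y => exp (-V y))
    (ha : 0 < a) (hk : 0 ≤ k) (x : Euc d) :
    Integrable fun y => exp (-V y - a * ‖y‖ ^ 2 + k * ⟪y, x⟫) • y := by
  refine (hint.const_mul (exp ((k * ‖x‖ + 1) ^ 2 / (4 * a)))).mono'
    (by fun_prop) (.of_forall fun y => ?_)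
  rw [norm_smul, norm_of_nonneg (exp_pos _).le, mul_comm]
  refine le_trans ?_ (one_add_norm_mul_exp_le ha hk (V y) le_rfl y)
  gcongr
  linarith

theorem hasGradientAt_integral_exp_tilt (hV : Continuous V)
    (hint : Integrable fun y => exp (-V y)) (ha : 0 < a) (hk : 0 ≤ k) (x : Euc d) :
    HasGradientAt (fun x => ∫ y, exp (-V y - a * ‖y‖ ^ 2 + k * ⟪y, x⟫))
      (k • ∫ y, exp (-V y - a * ‖y‖ ^ 2 + k * ⟪y, x⟫) • y) x := by
  have hderiv (y z : Euc d) : HasFDerivAt (fun x => exp (-V y - a * ‖y‖ ^ 2 + k * ⟪y, x⟫))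
      (innerSL ℝ (k • exp (-V y - a * ‖y‖ ^ 2 + k * ⟪y, z⟫) • y)) z := by
    have h := ((((innerSL ℝ y).hasFDerivAt (x := z)).const_mul k).const_add
      (-V y - a * ‖y‖ ^ 2)).exp
    simp only [innerSL_apply_apply] at h
    refine h.congr_fderiv ?_
    rw [map_smul, map_smul, smul_comm]
  have key := hasFDerivAt_integral_of_dominated_of_fderiv_le (μ := volume)
    (F := fun x y => exp (-V y - a * ‖y‖ ^ 2 + k * ⟪y, x⟫))
    (F' := fun x y => innerSL ℝ (k • exp (-V y - a * ‖y‖ ^ 2 + k * ⟪y, x⟫) • y))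
    (bound := fun y => k * (exp ((k * (‖x‖ + 1) + 1) ^ 2 / (4 * a)) * exp (-V y)))
    (x₀ := x) (Metric.ball_mem_nhds x one_pos)
    (.of_forall fun z => (integrable_exp_tilt hV hint ha hk z).aestronglyMeasurable)
    (integrable_exp_tilt hV hint ha hk x)
    (by
      have : Continuous fun y : Euc d => k • exp (-V y - a * ‖y‖ ^ 2 + k * ⟪y, x⟫) • y := by
        fun_prop
      exact ((innerSL ℝ).continuous.comp this).aestronglyMeasurable)
    (.of_forall fun y z hz => by
      have hz' : ‖z‖ ≤ ‖x‖ + 1 := by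
        have := norm_sub_norm_le z x
        rw [Metric.mem_ball, dist_eq_norm] at hz
        linarith
      rw [innerSL_apply_norm, norm_smul, norm_smul, norm_of_nonneg hk,
        norm_of_nonneg (exp_pos _).le]
      refine mul_le_mul_of_nonneg_left ?_ hk
      refine le_trans ?_ (one_add_norm_mul_exp_le ha hk (V y) hz' y)
      rw [mul_comm]
      gcongr
      linarith)
    ((hint.const_mul _).const_mul k)
    (.of_forall fun y z _ => hderiv y z)
  rw [hasGradientAt_iff_hasFDerivAt]
  refine key.congr_fderiv ?_
  have hcomm := (innerSL ℝ).integral_comp_comm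
    ((integrable_exp_tilt_smul hV hint ha hk x).fun_smul k)
  rw [integral_smul] at hcomm
  exact hcomm

theorem gradient_log_integral_exp_tilt (hV : Continuous V)
    (hint : Integrable fun y => exp (-V y)) (ha : 0 < a) (hk : 0 ≤ k) (x : Euc d) :
    gradient (fun x => log (∫ y, exp (-V y - a * ‖y‖ ^ 2 + k * ⟪y, x⟫))) x =
      (∫ y, exp (-V y - a * ‖y‖ ^ 2 + k * ⟪y, x⟫))⁻¹ •
        k • ∫ y, exp (-V y - a * ‖y‖ ^ 2 + k * ⟪y, x⟫) • y := by
  have hpos := integral_exp_pos (integrable_exp_tilt hV hint ha hk x)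
  have h := (hasGradientAt_integral_exp_tilt hV hint ha hk x).hasFDerivAt.log hpos.ne'
  refine HasGradientAt.gradient ?_
  rw [hasGradientAt_iff_hasFDerivAt]
  exact h.congr_fderiv (by simp only [map_smul])

end

/-- Tweedie-type identity for the isotropic stochastic interpolant velocity
with standard Gaussian base: `v_t(x) = (α̇_t/α_t) x + (β̇_t − α̇_t β_t/α_t)(α_t²/β_t) ∇b_t(x)`
on `(0,1)`. -/
theorem stochastic_interpolant_tweedie_identity
    (d : ℕ) (V₁ : Euc d → ℝ) (hV₁ : ContDiff ℝ 2 V₁)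
    (hμ₁ : (∫ y : Euc d, Real.exp (-V₁ y)) = 1)
    (α β : ℝ → ℝ) (hα : ContDiff ℝ 2 α) (hβ : ContDiff ℝ 2 β)
    (hα0 : α 0 = 1) (hα1 : α 1 = 0) (hβ0 : β 0 = 0) (hβ1 : β 1 = 1)
    (hαpos : ∀ t ∈ Ioo (0:ℝ) 1, 0 < α t) (hβpos : ∀ t ∈ Ioo (0:ℝ) 1, 0 < β t)
    (v : ℝ → Euc d → Euc d)
    -- `v t x = E[α̇_t X₀ + β̇_t X₁ | α_t X₀ + β_t X₁ = x]`, realized via the regular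
    -- conditional density of `X₁` given `X_t = x`:
    (hv : ∀ t ∈ Ioo (0:ℝ) 1, ∀ x : Euc d, v t x =
      (∫ y : Euc d, Real.exp (-V₁ y - ‖x - β t • y‖ ^ 2 / (2 * (α t) ^ 2)))⁻¹ •
        ∫ y : Euc d, Real.exp (-V₁ y - ‖x - β t • y‖ ^ 2 / (2 * (α t) ^ 2)) •
          ((deriv α t / α t) • (x - β t • y) + deriv β t • y)) :
    ∀ t ∈ Ioo (0:ℝ) 1, ∀ x : Euc d,
      v t x = (deriv α t / α t) • x +
        ((deriv β t - deriv α t * β t / α t) * ((α t) ^ 2 / β t)) •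
          gradient (cgf V₁ α β t) x := by
  intro t ht x
  have hA := hαpos t ht
  have hB := hβpos t ht
  have hint : Integrable fun y => exp (-V₁ y) := by
    by_contra h
    simp [integral_undef h] at hμ₁
  have ha : 0 < (β t) ^ 2 / (2 * (α t) ^ 2) := by positivity
  have hk : 0 ≤ β t / (α t) ^ 2 := by positivity
  have hgrad := gradient_log_integral_exp_tilt hV₁.continuous hint ha hk x
  have hpos := integral_exp_pos (integrable_exp_tilt hV₁.continuous hint ha hk x)
  have hI := integrable_exp_tilt hV₁.continuous hint ha hk x
  have hIy := integrable_exp_tilt_smul hV₁.continuous hint ha hk x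
  have hsq (y : Euc d) : exp (-V₁ y - ‖x - β t • y‖ ^ 2 / (2 * (α t) ^ 2)) =
      exp (-(‖x‖ ^ 2 / (2 * (α t) ^ 2))) *
        exp (-V₁ y - (β t) ^ 2 / (2 * (α t) ^ 2) * ‖y‖ ^ 2 + β t / (α t) ^ 2 * ⟪y, x⟫) := by
    rw [← exp_add, norm_sub_sq_real, norm_smul, inner_smul_right, real_inner_comm,
      norm_of_nonneg hB.le]
    congr 1
    field_simp
    ring
  have hlin (y : Euc d) : (deriv α t / α t) • (x - β t • y) + deriv β t • y =
      (deriv α t / α t) • x + (deriv β t - deriv α t * β t / α t) • y := by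
    module
  unfold cgf
  rw [hv t ht x, hgrad]
  have hnum : (∫ y, exp (-V₁ y - ‖x - β t • y‖ ^ 2 / (2 * (α t) ^ 2)) •
      ((deriv α t / α t) • (x - β t • y) + deriv β t • y)) =
      exp (-(‖x‖ ^ 2 / (2 * (α t) ^ 2))) •
        ((∫ y, exp (-V₁ y - (β t) ^ 2 / (2 * (α t) ^ 2) * ‖y‖ ^ 2 + β t / (α t) ^ 2 * ⟪y, x⟫)) •
            (deriv α t / α t) • x +
          (deriv β t - deriv α t * β t / α t) •
            ∫ y, exp (-V₁ y - (β t) ^ 2 / (2 * (α t) ^ 2) * ‖y‖ ^ 2 +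
              β t / (α t) ^ 2 * ⟪y, x⟫) • y) := by
    rw [← integral_smul_const, ← integral_smul,
      ← integral_add (hI.smul_const _) (hIy.fun_smul _), ← integral_smul]
    refine integral_congr_ae (.of_forall fun y => ?_)
    simp only [hsq, hlin]
    module
  rw [hnum]
  simp only [hsq, integral_const_mul]
  generalize (∫ y, exp (-V₁ y - (β t) ^ 2 / (2 * (α t) ^ 2) * ‖y‖ ^ 2 +
    β t / (α t) ^ 2 * ⟪y, x⟫)) = Z at hpos ⊢
  match_scalars <;> field_simp
end
end

section
/- Let μ0 = N(m_0, Σ_0) and μ1 = N(m_1, Σ_1) be Gaussian measures on ℝ^d with commuting positive definite covariance matrices Σ_0, Σ_1. Let (μ_t) be the isotropic stochastic interpolant with coefficients (α_t), (β_t), with velocity field v_t and flow map f^v_t. Then, setting m_t = α_t m_0 + β_t m_1 and Σ_t = α_t² Σ_0 + β_t² Σ_1, it holds that v_t(x) = ṁ_t + (1/2) Σ̇_t Σ_t^{-1} (x − m_t) and f^v_t(x) = m_t + Σ_t^{1/2} Σ_0^{-1/2} (x − m_0) for all t ∈ [0,1] and x ∈ ℝ^d. -/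
open MeasureTheory Real Set
open scoped RealInnerProductSpace

noncomputable section

/-- The Gaussian potential `x ↦ ½⟨x − m, Σ⁻¹(x − m)⟩` (normalizing constant omitted, as it
cancels in normalized conditional densities). -/
def gaussPot {d : ℕ} (m : Euc d) (S : Matrix (Fin d) (Fin d) ℝ) (x : Euc d) : ℝ :=
  ⟪x - m, Matrix.toEuclideanLin S⁻¹ (x - m)⟫ / 2

/-- Unnormalized conditional density of `X₁` given `X_t = α_t X₀ + β_t X₁ = x`, when
`X₀ ∼ e^{-V₀}` and `X₁ ∼ e^{-V₁}` are independent. -/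
def condDens {d : ℕ} (V₀ V₁ : Euc d → ℝ) (α β : ℝ → ℝ) (t : ℝ) (x y : Euc d) : ℝ :=
  Real.exp (-V₀ ((α t)⁻¹ • (x - β t • y)) - V₁ y)

section OddPart

variable {E : Type*} [NormedAddCommGroup E] [InnerProductSpace ℝ E] [FiniteDimensional ℝ E]
  [MeasurableSpace E] [BorelSpace E]

lemma integrable_exp_neg_mul_norm_sq {c : ℝ} (hc : 0 < c) :
    Integrable (fun z : E => Real.exp (-c * ‖z‖ ^ 2)) := by
  have h := (GaussianFourier.integrable_cexp_neg_mul_sq_norm_add (V := E) (b := (c : ℂ))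
    (by simpa using hc) 0 0).norm
  refine h.congr (Filter.Eventually.of_forall fun z => ?_)
  simp only [Complex.norm_exp]
  norm_cast
  simp

lemma mul_exp_neg_mul_sq_le {c : ℝ} (hc : 0 < c) (r : ℝ) :
    r * Real.exp (-c * r ^ 2) ≤ (1 + c⁻¹) * Real.exp (-(c / 2) * r ^ 2) := by
  have h1 : r ≤ (1 + c⁻¹) * Real.exp (c / 2 * r ^ 2) := by
    have h2 : c / 2 * r ^ 2 + 1 ≤ Real.exp (c / 2 * r ^ 2) := Real.add_one_le_exp _
    have h3 : 0 < c⁻¹ := inv_pos.2 hc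
    have h4 : c⁻¹ * c = 1 := inv_mul_cancel₀ hc.ne'
    calc r ≤ 1 + r ^ 2 / 2 := by nlinarith [sq_nonneg (r - 1)]
      _ ≤ (1 + c⁻¹) * (c / 2 * r ^ 2 + 1) := by
        have : c⁻¹ * (c / 2 * r ^ 2) = r ^ 2 / 2 := by
          rw [← mul_assoc, mul_div_assoc', h4]; ring
        have : 0 ≤ c / 2 * r ^ 2 := by positivity
        nlinarith
      _ ≤ _ := by gcongr
  calc r * Real.exp (-c * r ^ 2)
      ≤ (1 + c⁻¹) * Real.exp (c / 2 * r ^ 2) * Real.exp (-c * r ^ 2) := by gcongr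
    _ = _ := by rw [mul_assoc, ← Real.exp_add]; ring_nf

/-- The weighted average of an affine map against an even weight centred at `y₀` with Gaussian
tails is its value at `y₀`. -/
lemma average_affine_of_even {G : E → ℝ} (hG : Continuous G) (hpos : ∀ z, 0 < G z)
    (heven : ∀ z, G (-z) = G z) {C c : ℝ} (hc : 0 < c)
    (hle : ∀ z, G z ≤ C * Real.exp (-c * ‖z‖ ^ 2)) (y₀ a : E) (k : ℝ) :
    (∫ y, G (y - y₀))⁻¹ • ∫ y, G (y - y₀) • (a + k • (y - y₀)) = a := by
  have hC : 0 ≤ C := by simpa using (hpos 0).le.trans (hle 0)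
  have hGint : Integrable G := by
    refine ((integrable_exp_neg_mul_norm_sq (E := E) hc).const_mul C).mono'
      hG.aestronglyMeasurable (Filter.Eventually.of_forall fun z => ?_)
    rw [Real.norm_of_nonneg (hpos z).le]
    exact hle z
  have hGint' : Integrable (fun z => G z • z) := by
    refine ((integrable_exp_neg_mul_norm_sq (E := E) (half_pos hc)).const_mul
      (C * (1 + c⁻¹))).mono' (hG.smul continuous_id).aestronglyMeasurable
      (Filter.Eventually.of_forall fun z => ?_)
    rw [norm_smul, Real.norm_of_nonneg (hpos z).le]
    calc G z * ‖z‖ ≤ C * Real.exp (-c * ‖z‖ ^ 2) * ‖z‖ := by gcongr; exact hle z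
      _ = C * (‖z‖ * Real.exp (-c * ‖z‖ ^ 2)) := by ring
      _ ≤ C * ((1 + c⁻¹) * Real.exp (-(c / 2) * ‖z‖ ^ 2)) := by
        exact mul_le_mul_of_nonneg_left (mul_exp_neg_mul_sq_le hc _) hC
      _ = _ := by ring
  have hodd : ∫ z, G z • z = 0 := by
    have h := integral_neg_eq_self (fun z => G z • z) (volume : Measure E)
    simp only [heven, smul_neg, integral_neg] at h
    have h2 : (2 : ℝ) • ∫ z, G z • z = 0 := by
      rw [two_smul, add_eq_zero_iff_eq_neg, h]
    exact (smul_eq_zero.1 h2).resolve_left two_ne_zero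
  have hne : ∫ z, G z ≠ 0 := by
    refine ((integral_pos_iff_support_of_nonneg (fun z => (hpos z).le) hGint).2 ?_).ne'
    have : Function.support G = univ := Set.eq_univ_of_forall fun z => (hpos z).ne'
    rw [this]
    exact (Measure.measure_univ_pos).2 (NeZero.ne _)
  rw [integral_sub_right_eq_self G y₀,
    integral_sub_right_eq_self (fun z => G z • (a + k • z)) y₀]
  have hsplit : ∫ z, G z • (a + k • z) = (∫ z, G z) • a + k • ∫ z, G z • z := by
    rw [← integral_smul_const, ← integral_smul]
    refine Eq.trans ?_ (integral_add (hGint.smul_const a) (hGint'.smul k))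
    congr 1 with z
    rw [smul_add, smul_comm (G z) k]
  rw [hsplit, hodd, smul_zero, add_zero, smul_smul, inv_mul_cancel₀ hne, one_smul]

end OddPart

section Matrices

variable {d : ℕ} {M N : Matrix (Fin d) (Fin d) ℝ}

open Matrix

lemma toEuclideanLin_mul_apply (M N : Matrix (Fin d) (Fin d) ℝ) (x : Euc d) :
    toEuclideanLin (M * N) x = toEuclideanLin M (toEuclideanLin N x) := by
  simp

lemma toEuclideanLin_inv_apply_self (hM : IsUnit M) (x : Euc d) :
    toEuclideanLin M⁻¹ (toEuclideanLin M x) = x := by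
  rw [← toEuclideanLin_mul_apply, Matrix.nonsing_inv_mul _ ((M.isUnit_iff_isUnit_det).1 hM)]
  simp

lemma toEuclideanLin_apply_inv_self (hM : IsUnit M) (x : Euc d) :
    toEuclideanLin M (toEuclideanLin M⁻¹ x) = x := by
  rw [← toEuclideanLin_mul_apply, Matrix.mul_nonsing_inv _ ((M.isUnit_iff_isUnit_det).1 hM)]
  simp

lemma inner_toEuclideanLin_comm (hM : M.IsHermitian) (x y : Euc d) :
    ⟪toEuclideanLin M x, y⟫ = ⟪x, toEuclideanLin M y⟫ :=
  isSymmetric_toEuclideanLin_iff.2 hM x y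

lemma inner_toEuclideanLin_nonneg (hM : M.PosSemidef) (x : Euc d) :
    0 ≤ ⟪x, toEuclideanLin M x⟫ := by
  simpa using (isPositive_toEuclideanLin_iff.2 hM).re_inner_nonneg_right x

lemma inner_toEuclideanLin_pos (hM : M.PosDef) {x : Euc d} (hx : x ≠ 0) :
    0 < ⟪x, toEuclideanLin M x⟫ := by
  have h := hM.dotProduct_mulVec_pos (x := x.ofLp) (by simpa using hx)
  rw [EuclideanSpace.inner_eq_star_dotProduct, dotProduct_comm]
  simpa using h

lemma continuous_inner_toEuclideanLin (M : Matrix (Fin d) (Fin d) ℝ) :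
    Continuous fun x : Euc d => ⟪x, toEuclideanLin M x⟫ :=
  continuous_id.inner (toEuclideanLin M).continuous_of_finiteDimensional

lemma exists_mul_norm_sq_le_inner (hM : M.PosDef) :
    ∃ c > 0, ∀ x : Euc d, c * ‖x‖ ^ 2 ≤ ⟪x, toEuclideanLin M x⟫ := by
  obtain ⟨c, hc, h⟩ := (isCompact_sphere (0 : Euc d) 1).exists_forall_le'
    (continuous_inner_toEuclideanLin M).continuousOn (a := 0)
    fun x hx => inner_toEuclideanLin_pos hM (ne_zero_of_mem_unit_sphere ⟨x, hx⟩)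
  refine ⟨c, hc, fun x => ?_⟩
  rcases eq_or_ne x 0 with rfl | hx
  · simp
  have hn : 0 < ‖x‖ := norm_pos_iff.2 hx
  have h1 := h (‖x‖⁻¹ • x) (by simp [norm_smul, hn.ne'])
  rw [map_smul, real_inner_smul_left, real_inner_smul_right] at h1
  calc c * ‖x‖ ^ 2 ≤ ‖x‖⁻¹ * (‖x‖⁻¹ * ⟪x, toEuclideanLin M x⟫) * ‖x‖ ^ 2 := by gcongr
    _ = _ := by field_simp

lemma toEuclideanLin_inv_apply_of_eigen (hM : IsUnit M) {e : Euc d} {s : ℝ} (hs : s ≠ 0)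
    (he : toEuclideanLin M e = s • e) : toEuclideanLin M⁻¹ e = s⁻¹ • e := by
  have h := toEuclideanLin_inv_apply_self hM e
  rw [he, map_smul] at h
  rw [← h, smul_smul, inv_mul_cancel₀ hs, one_smul, h]

lemma eigenvalue_pos (hM : M.PosDef) {e : Euc d} (he0 : e ≠ 0) {s : ℝ}
    (he : toEuclideanLin M e = s • e) : 0 < s := by
  have h := inner_toEuclideanLin_pos hM he0
  rw [he, real_inner_smul_right] at h
  exact pos_of_mul_pos_left h real_inner_self_nonneg

/-- An eigenvector of `R * R`, with `R` positive semidefinite, is an eigenvector of `R`. -/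
lemma toEuclideanLin_sqrt_apply_of_eigen {R : Matrix (Fin d) (Fin d) ℝ} (hR : R.PosSemidef)
    (hRM : R * R = M) {e : Euc d} {s : ℝ} (hs : 0 < s) (he : toEuclideanLin M e = s • e) :
    toEuclideanLin R e = √s • e := by
  set w := toEuclideanLin R e - √s • e with hw
  have h1 : toEuclideanLin R w = -(√s • w) := by
    rw [hw, map_sub, map_smul, ← toEuclideanLin_mul_apply, hRM, he, smul_sub, smul_smul,
      Real.mul_self_sqrt hs.le]
    abel
  have h2 := inner_toEuclideanLin_nonneg hR w
  rw [h1, inner_neg_right, real_inner_smul_right] at h2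
  have h3 : 0 < √s := Real.sqrt_pos.2 hs
  have h4 : ⟪w, w⟫ = 0 := le_antisymm (by nlinarith) real_inner_self_nonneg
  exact sub_eq_zero.1 (inner_self_eq_zero.1 h4)

/-- Vectors are determined by their inner products with the joint eigenvectors of two commuting
symmetric matrices. -/
lemma eq_of_inner_joint_eigenvector_eq (hM : M.IsHermitian) (hN : N.IsHermitian)
    (hMN : M * N = N * M) {x y : Euc d}
    (h : ∀ (e : Euc d) (p q : ℝ), e ≠ 0 → toEuclideanLin M e = p • e →
      toEuclideanLin N e = q • e → ⟪e, x⟫ = ⟪e, y⟫) : x = y := by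
  have hcomm : Commute (toEuclideanLin M) (toEuclideanLin N) := by
    ext1 z
    exact (toEuclideanLin_mul_apply M N z).symm.trans
      ((congrArg (fun A => toEuclideanLin A z) hMN).trans (toEuclideanLin_mul_apply N M z))
  have htop := LinearMap.IsSymmetric.iSup_iSup_eigenspace_inf_eigenspace_eq_top_of_commute
    (isSymmetric_toEuclideanLin_iff.2 hM) (isSymmetric_toEuclideanLin_iff.2 hN) hcomm
  have hle : (⊤ : Submodule ℝ (Euc d)) ≤ (ℝ ∙ (x - y))ᗮ := by
    rw [← htop]
    refine iSup_le fun p => iSup_le fun q e he => ?_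
    rw [Submodule.mem_orthogonal_singleton_iff_inner_left, inner_sub_right, sub_eq_zero]
    rcases eq_or_ne e 0 with rfl | he0
    · simp
    exact h e p q he0 (Module.End.mem_eigenspace_iff.1 he.1) (Module.End.mem_eigenspace_iff.1 he.2)
  have hz := hle (Submodule.mem_top (x := x - y))
  rw [Submodule.mem_orthogonal_singleton_iff_inner_left] at hz
  exact sub_eq_zero.1 (inner_self_eq_zero.1 hz)

end Matrices

section Velocity

variable {d : ℕ}

open Matrix

lemma gaussPot_add (m : Euc d) {S : Matrix (Fin d) (Fin d) ℝ} (hS : S.PosDef) (u z : Euc d) :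
    gaussPot m S (m + toEuclideanLin S u + z) =
      ⟪u, toEuclideanLin S u⟫ / 2 + ⟪u, z⟫ + ⟪z, toEuclideanLin S⁻¹ z⟫ / 2 := by
  have h : m + toEuclideanLin S u + z - m = toEuclideanLin S u + z := by abel
  rw [gaussPot, h, map_add, toEuclideanLin_inv_apply_self hS.isUnit, inner_add_left,
    inner_add_right, inner_add_right, ← inner_toEuclideanLin_comm hS.inv.isHermitian,
    toEuclideanLin_inv_apply_self hS.isUnit, real_inner_comm u (toEuclideanLin S u),
    real_inner_comm u z]
  ring

/-- The conditional mean of `a' X₀ + b' X₁` given `X_t = x` for Gaussian endpoints. -/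
lemma gaussian_conditional_mean (m₀ m₁ : Euc d) {S₀ S₁ : Matrix (Fin d) (Fin d) ℝ}
    (hS₀ : S₀.PosDef) (hS₁ : S₁.PosDef) {α β : ℝ → ℝ} {t : ℝ} (hαt : 0 < α t)
    (a' b' : ℝ) (x : Euc d) :
    (∫ y : Euc d, condDens (gaussPot m₀ S₀) (gaussPot m₁ S₁) α β t x y)⁻¹ •
        ∫ y : Euc d, condDens (gaussPot m₀ S₀) (gaussPot m₁ S₁) α β t x y •
          ((a' / α t) • (x - β t • y) + b' • y) =
      (a' • m₀ + b' • m₁) +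
        toEuclideanLin (((α t * a') • S₀ + (β t * b') • S₁) *
          ((α t) ^ 2 • S₀ + (β t) ^ 2 • S₁)⁻¹) (x - (α t • m₀ + β t • m₁)) := by
  set S := (α t) ^ 2 • S₀ + (β t) ^ 2 • S₁ with hS
  have hSpd : S.PosDef :=
    (hS₀.smul (by positivity)).add_posSemidef (hS₁.posSemidef.smul (by positivity))
  set u := toEuclideanLin S⁻¹ (x - (α t • m₀ + β t • m₁)) with hu
  have hx : x = α t • m₀ + β t • m₁ + (α t ^ 2 • toEuclideanLin S₀ u +
      β t ^ 2 • toEuclideanLin S₁ u) := by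
    have h := toEuclideanLin_apply_inv_self hSpd.isUnit (x - (α t • m₀ + β t • m₁))
    rw [← hu, hS, map_add, map_smul, map_smul, LinearMap.add_apply, LinearMap.smul_apply,
      LinearMap.smul_apply] at h
    rw [h]; abel
  set y₀ := m₁ + toEuclideanLin S₁ (β t • u) with hy₀
  have hy (y : Euc d) : (α t)⁻¹ • (x - β t • y) =
      m₀ + toEuclideanLin S₀ (α t • u) + (-(β t / α t)) • (y - y₀) := by
    rw [hx, hy₀, map_smul, map_smul]
    match_scalars <;> field_simp
  set K := ⟪α t • u, toEuclideanLin S₀ (α t • u)⟫ / 2 +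
    ⟪β t • u, toEuclideanLin S₁ (β t • u)⟫ / 2 with hK
  set G : Euc d → ℝ := fun z => Real.exp (-K -
    (-(β t / α t)) ^ 2 * (⟪z, toEuclideanLin S₀⁻¹ z⟫ / 2) -
      ⟪z, toEuclideanLin S₁⁻¹ z⟫ / 2) with hG
  have hD (y : Euc d) : condDens (gaussPot m₀ S₀) (gaussPot m₁ S₁) α β t x y = G (y - y₀) := by
    have hy1 : gaussPot m₁ S₁ y = gaussPot m₁ S₁ (y₀ + (y - y₀)) := by
      rw [add_sub_cancel]
    rw [condDens, hy1, hy, gaussPot_add _ hS₀, hy₀, gaussPot_add _ hS₁, ← hy₀, hG]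
    simp only [map_smul, real_inner_smul_left, real_inner_smul_right, hK]
    congr 1
    field_simp
    ring
  have hL (y : Euc d) : (a' / α t) • (x - β t • y) + b' • y =
      (a' • (m₀ + toEuclideanLin S₀ (α t • u)) + b' • y₀) +
        (b' - a' * (β t / α t)) • (y - y₀) := by
    rw [div_eq_mul_inv, mul_smul, hy]
    module
  obtain ⟨c, hc, hcle⟩ := exists_mul_norm_sq_le_inner hS₁.inv
  simp only [hD, hL]
  rw [average_affine_of_even (C := Real.exp (-K)) (c := c / 2) _ _ _ (half_pos hc) _]
  · rw [toEuclideanLin_mul_apply, ← hu, hy₀, map_add, map_smul, map_smul, map_smul, map_smul,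
      LinearMap.add_apply, LinearMap.smul_apply, LinearMap.smul_apply]
    module
  · have h0 := continuous_inner_toEuclideanLin S₀⁻¹
    have h1 := continuous_inner_toEuclideanLin S₁⁻¹
    fun_prop
  · exact fun z => Real.exp_pos _
  · intro z
    simp [hG]
  · intro z
    rw [hG, ← Real.exp_add, Real.exp_le_exp]
    have h0 := inner_toEuclideanLin_nonneg hS₀.inv.posSemidef z
    have h2 : 0 ≤ (-(β t / α t)) ^ 2 * (⟪z, toEuclideanLin S₀⁻¹ z⟫ / 2) := by positivity
    linarith [hcle z]

end Velocity

/-- A solution of `φ' = a' + s' / (2 s) (φ - a)` satisfies `φ = a + √(s / s 0) (φ 0 - a 0)`. -/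
lemma eq_of_scalar_flow {φ a s a' s' : ℝ → ℝ} {T : ℝ} (hT : 0 ≤ T)
    (hφc : ContinuousOn φ (Icc 0 T)) (hac : ContinuousOn a (Icc 0 T))
    (hsc : ContinuousOn s (Icc 0 T)) (hspos : ∀ t ∈ Icc 0 T, 0 < s t)
    (ha : ∀ t ∈ Ioo 0 T, HasDerivAt a (a' t) t) (hs : ∀ t ∈ Ioo 0 T, HasDerivAt s (s' t) t)
    (hφ : ∀ t ∈ Ioo 0 T, HasDerivAt φ (a' t + s' t / (2 * s t) * (φ t - a t)) t) :
    φ T = a T + √(s T) / √(s 0) * (φ 0 - a 0) := by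
  have hsq : ∀ t ∈ Icc 0 T, √(s t) ≠ 0 := fun t ht => (Real.sqrt_pos.2 (hspos t ht)).ne'
  have h0 := hsq 0 ⟨le_rfl, hT⟩
  have hsT := hsq T ⟨hT, le_rfl⟩
  suffices h : (φ T - a T) / √(s T) = (φ 0 - a 0) / √(s 0) by
    field_simp at h ⊢
    linarith
  rcases hT.eq_or_lt with rfl | hT
  · rfl
  obtain ⟨c, hc, h⟩ := exists_hasDerivAt_eq_slope (fun t => (φ t - a t) / √(s t)) (fun _ => 0) hT
    ((hφc.sub hac).div hsc.sqrt hsq) fun t ht => by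
      have hst := hspos t (Ioo_subset_Icc_self ht)
      have hne := hsq t (Ioo_subset_Icc_self ht)
      refine (((hφ t ht).sub (ha t ht)).div ((hs t ht).sqrt hst.ne') hne).congr_deriv ?_
      have h2 : √(s t) * √(s t) = s t := Real.mul_self_sqrt hst.le
      rw [div_eq_zero_iff]
      left
      have h3 : s' t / (2 * s t) = s' t / (2 * √(s t)) / √(s t) := by
        rw [div_div, mul_assoc, h2]
      rw [Pi.sub_apply, h3]
      field_simp
      ring
  rw [eq_comm, div_eq_zero_iff, sub_eq_zero] at h
  exact h.resolve_right (by linarith)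

/-- For Gaussian endpoints `μ₀ = N(m₀, S₀)`, `μ₁ = N(m₁, S₁)` with
commuting positive definite covariances, the isotropic stochastic interpolant has velocity
`v_t(x) = ṁ_t + ½ Σ̇_t Σ_t⁻¹ (x − m_t)` and flow `f^v_t(x) = m_t + Σ_t^{1/2} S₀^{-1/2} (x − m₀)`,
where `m_t = α_t m₀ + β_t m₁` and `Σ_t = α_t² S₀ + β_t² S₁`. (The matrix square roots are
specified as arbitrary positive semidefinite square roots, which are unique.) -/
theorem gaussian_interpolant_velocity_and_flow
    (d : ℕ) (m₀ m₁ : Euc d) (S₀ S₁ : Matrix (Fin d) (Fin d) ℝ)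
    (hS₀ : S₀.PosDef) (hS₁ : S₁.PosDef) (hcomm : S₀ * S₁ = S₁ * S₀)
    (α β : ℝ → ℝ) (hα : ContDiff ℝ 2 α) (hβ : ContDiff ℝ 2 β)
    (hα0 : α 0 = 1) (hα1 : α 1 = 0) (hβ0 : β 0 = 0) (hβ1 : β 1 = 1)
    (hαpos : ∀ t ∈ Ioo (0:ℝ) 1, 0 < α t) (hβpos : ∀ t ∈ Ioo (0:ℝ) 1, 0 < β t)
    (v : ℝ → Euc d → Euc d)
    -- `v t x = E[α̇_t X₀ + β̇_t X₁ | X_t = x]`, realized via the regular conditional density: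
    (hv : ∀ t ∈ Ioo (0:ℝ) 1, ∀ x : Euc d, v t x =
      (∫ y : Euc d, condDens (gaussPot m₀ S₀) (gaussPot m₁ S₁) α β t x y)⁻¹ •
        ∫ y : Euc d, condDens (gaussPot m₀ S₀) (gaussPot m₁ S₁) α β t x y •
          ((deriv α t / α t) • (x - β t • y) + deriv β t • y))
    (f : ℝ → Euc d → Euc d)
    (hf0 : ∀ x : Euc d, f 0 x = x)
    (hfc : ∀ x : Euc d, ContinuousOn (fun s => f s x) (Icc (0:ℝ) 1))
    (hflow : ∀ x : Euc d, ∀ t ∈ Ioo (0:ℝ) 1, HasDerivAt (fun s => f s x) (v t (f t x)) t) :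
    (∀ t ∈ Ioo (0:ℝ) 1, ∀ x : Euc d,
      v t x = (deriv α t • m₀ + deriv β t • m₁) +
        (1 / 2 : ℝ) • Matrix.toEuclideanLin
            (((2 * α t * deriv α t) • S₀ + (2 * β t * deriv β t) • S₁) *
              ((α t) ^ 2 • S₀ + (β t) ^ 2 • S₁)⁻¹)
          (x - (α t • m₀ + β t • m₁))) ∧
    (∀ t ∈ Icc (0:ℝ) 1, ∀ x : Euc d, ∀ St S₀r : Matrix (Fin d) (Fin d) ℝ,
      St.PosSemidef → St * St = (α t) ^ 2 • S₀ + (β t) ^ 2 • S₁ →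
      S₀r.PosSemidef → S₀r * S₀r = S₀ →
      f t x = (α t • m₀ + β t • m₁) + Matrix.toEuclideanLin (St * S₀r⁻¹) (x - m₀)) := by
  have hvel : ∀ t ∈ Ioo (0:ℝ) 1, ∀ x : Euc d,
      v t x = (deriv α t • m₀ + deriv β t • m₁) +
        (1 / 2 : ℝ) • Matrix.toEuclideanLin
            (((2 * α t * deriv α t) • S₀ + (2 * β t * deriv β t) • S₁) *
              ((α t) ^ 2 • S₀ + (β t) ^ 2 • S₁)⁻¹)
          (x - (α t • m₀ + β t • m₁)) := by
    intro t ht x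
    rw [hv t ht, gaussian_conditional_mean m₀ m₁ hS₀ hS₁ (hαpos t ht),
      ← LinearMap.smul_apply, ← map_smul, ← smul_mul_assoc, smul_add, smul_smul, smul_smul]
    ring_nf
  refine ⟨hvel, fun t ht x St S₀r hSt hStsq hS₀r hS₀rsq => ?_⟩
  refine eq_of_inner_joint_eigenvector_eq hS₀.isHermitian hS₁.isHermitian hcomm
    fun e p q he0 hep heq => ?_
  have hp := eigenvalue_pos hS₀ he0 hep
  have hq := eigenvalue_pos hS₁ he0 heq
  have hnonzero : ∀ r ∈ Icc (0:ℝ) 1, α r ≠ 0 ∨ β r ≠ 0 := fun r hr => by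
    rcases hr.1.eq_or_lt with rfl | h0
    · exact .inl (by simp [hα0])
    rcases hr.2.eq_or_lt with rfl | h1
    · exact .inr (by simp [hβ1])
    exact .inl (hαpos r ⟨h0, h1⟩).ne'
  set s : ℝ → ℝ := fun r => α r ^ 2 * p + β r ^ 2 * q with hs_def
  have hspos : ∀ r ∈ Icc (0:ℝ) 1, 0 < s r := fun r hr => by
    rcases hnonzero r hr with h | h
    · exact add_pos_of_pos_of_nonneg (by positivity) (by positivity)
    · exact add_pos_of_nonneg_of_pos (by positivity) (by positivity)
  have hSe (r : ℝ) : Matrix.toEuclideanLin ((α r) ^ 2 • S₀ + (β r) ^ 2 • S₁) e = s r • e := by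
    rw [map_add, map_smul, map_smul, LinearMap.add_apply, LinearMap.smul_apply,
      LinearMap.smul_apply, hep, heq]
    module
  have hα' (r : ℝ) : HasDerivAt α (deriv α r) r := (hα.differentiable (by norm_num) r).hasDerivAt
  have hβ' (r : ℝ) : HasDerivAt β (deriv β r) r := (hβ.differentiable (by norm_num) r).hasDerivAt
  have hsub : Icc 0 t ⊆ Icc (0:ℝ) 1 := Icc_subset_Icc_right ht.2
  have hsub' : Ioo 0 t ⊆ Ioo (0:ℝ) 1 := Ioo_subset_Ioo_right ht.2
  have hscalar := eq_of_scalar_flow (φ := fun r => ⟪e, f r x⟫)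
    (a := fun r => ⟪e, α r • m₀ + β r • m₁⟫) (s := s)
    (a' := fun r => ⟪e, deriv α r • m₀ + deriv β r • m₁⟫)
    (s' := fun r => 2 * α r * deriv α r * p + 2 * β r * deriv β r * q) ht.1
    (continuousOn_const.inner ((hfc x).mono hsub))
    (continuous_const.inner ((hα.continuous.smul continuous_const).add
      (hβ.continuous.smul continuous_const))).continuousOn
    (((hα.continuous.pow 2).mul continuous_const).add
      ((hβ.continuous.pow 2).mul continuous_const)).continuousOn
    (fun r hr => hspos r (hsub hr))
    (fun r _ => by
      simpa using (hasDerivAt_const r e).inner ℝ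
        (((hα' r).smul_const m₀).add ((hβ' r).smul_const m₁)))
    (fun r _ => by
      refine ((((hα' r).pow 2).mul_const p).add (((hβ' r).pow 2).mul_const q)).congr_deriv ?_
      ring)
    (fun r hr => by
      have hr1 := hsub' hr
      have hsr := hspos r (Ioo_subset_Icc_self hr1)
      refine ((hasDerivAt_const r e).inner ℝ (hflow x r hr1)).congr_deriv ?_
      have hSpd : ((α r) ^ 2 • S₀ + (β r) ^ 2 • S₁).PosDef :=
        (hS₀.smul (pow_pos (hαpos r hr1) 2)).add_posSemidef (hS₁.posSemidef.smul (sq_nonneg _))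
      have hherm : ((2 * α r * deriv α r) • S₀ + (2 * β r * deriv β r) • S₁).IsHermitian :=
        (hS₀.isHermitian.smul (.all _)).add (hS₁.isHermitian.smul (.all _))
      have hde : Matrix.toEuclideanLin
          ((2 * α r * deriv α r) • S₀ + (2 * β r * deriv β r) • S₁) e =
          (2 * α r * deriv α r * p + 2 * β r * deriv β r * q) • e := by
        rw [map_add, map_smul, map_smul, LinearMap.add_apply, LinearMap.smul_apply,
          LinearMap.smul_apply, hep, heq]
        module
      rw [inner_zero_left, add_zero, hvel r hr1, inner_add_right, real_inner_smul_right,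
        toEuclideanLin_mul_apply, ← inner_toEuclideanLin_comm hherm, hde, real_inner_smul_left,
        ← inner_toEuclideanLin_comm hSpd.inv.isHermitian,
        toEuclideanLin_inv_apply_of_eigen hSpd.isUnit hsr.ne' (hSe r), real_inner_smul_left,
        inner_sub_right]
      field_simp)
  have hs0 : s 0 = p := by simp [hs_def, hα0, hβ0]
  have hS₀runit : IsUnit S₀r := isUnit_of_mul_isUnit_left (hS₀rsq ▸ hS₀.isUnit)
  rw [hscalar, inner_add_right _ (α t • m₀ + β t • m₁), toEuclideanLin_mul_apply,
    ← inner_toEuclideanLin_comm hSt.isHermitian,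
    toEuclideanLin_sqrt_apply_of_eigen hSt hStsq (hspos t ht) (hSe t), real_inner_smul_left,
    ← inner_toEuclideanLin_comm hS₀r.inv.isHermitian,
    toEuclideanLin_inv_apply_of_eigen hS₀runit (Real.sqrt_pos.2 hp).ne'
      (toEuclideanLin_sqrt_apply_of_eigen hS₀r hS₀rsq hp hep),
    real_inner_smul_left, hs0, hf0, hα0, hβ0, one_smul, zero_smul, add_zero, inner_sub_right]
  ring
end
end

section
/- Let μ0 = N(m_0, Σ_0) and μ1 = N(m_1, Σ_1) be Gaussian measures on ℝ^d with commuting positive definite covariance matrices Σ_0, Σ_1, and let f^v_t be the flow map of the isotropic stochastic interpolant with any coefficients (α_t), (β_t). Then the time-one flow map equals the quadratic-cost optimal transport map from μ0 to μ1: f^v_1(x) = m_1 + Σ_1^{1/2} Σ_0^{-1/2} (x − m_0), independently of the choice of coefficients. -/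
open MeasureTheory Real Set
open scoped RealInnerProductSpace

noncomputable section

lemma eq_of_inner_joint_eigenvectors_eq {E : Type*} [NormedAddCommGroup E]
    [InnerProductSpace ℝ E] [FiniteDimensional ℝ E] {A B : E →ₗ[ℝ] E}
    (hA : A.IsSymmetric) (hB : B.IsSymmetric) (hAB : Commute A B) {x y : E}
    (h : ∀ (u : E) (a b : ℝ), A u = a • u → B u = b • u → ⟪u, x⟫ = ⟪u, y⟫) : x = y := by
  refine ext_inner_left ℝ fun w => ?_
  have hw : w ∈ ⨆ a, ⨆ b, Module.End.eigenspace A a ⊓ Module.End.eigenspace B b := by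
    rw [hA.iSup_iSup_eigenspace_inf_eigenspace_eq_top_of_commute hB hAB]
    trivial
  suffices (⨆ a, ⨆ b, Module.End.eigenspace A a ⊓ Module.End.eigenspace B b) ≤
      LinearMap.ker (innerₗ E (x - y)) by
    have := this hw
    rw [LinearMap.mem_ker, innerₗ_apply_apply, real_inner_comm, inner_sub_right, sub_eq_zero] at this
    exact this
  refine iSup₂_le fun a b u hu => ?_
  rw [LinearMap.mem_ker, innerₗ_apply_apply, real_inner_comm, inner_sub_right, sub_eq_zero]
  exact h u a b (Module.End.mem_eigenspace_iff.1 hu.1) (Module.End.mem_eigenspace_iff.1 hu.2)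

lemma LinearMap.IsPositive.apply_eq_sqrt_smul {E : Type*} [NormedAddCommGroup E]
    [InnerProductSpace ℝ E] {R : E →ₗ[ℝ] E} (hR : R.IsPositive) {u : E} {a : ℝ} (ha : 0 < a)
    (h : R (R u) = a • u) : R u = √a • u := by
  rw [← sub_eq_zero]
  set e := R u - √a • u with he
  have h1 : R e = -(√a • e) := by
    rw [he, map_sub, map_smul, h, smul_sub, smul_smul, Real.mul_self_sqrt ha.le]
    abel
  have h2 : 0 ≤ ⟪R e, e⟫ := by simpa using hR.re_inner_nonneg_left e
  rw [h1, inner_neg_left, real_inner_smul_left, real_inner_self_eq_norm_sq] at h2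
  have h3 : ‖e‖ ^ 2 ≤ 0 := by
    by_contra! h4
    have := mul_pos (Real.sqrt_pos.2 ha) h4
    linarith
  simpa using h3

section
variable {E : Type*} [NormedAddCommGroup E] [InnerProductSpace ℝ E] [FiniteDimensional ℝ E]
  [MeasurableSpace E] [BorelSpace E]

lemma integrable_exp_neg_mul_sq_norm_sub {c : ℝ} (hc : 0 < c) (m : E) :
    Integrable fun y : E => Real.exp (-c * ‖y - m‖ ^ 2) := by
  have h := (GaussianFourier.integrable_cexp_neg_mul_sq_norm_add (V := E) (b := (c : ℂ))
    (by simpa using hc) 0 0).norm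
  refine (h.comp_sub_right m).congr (.of_forall fun y => ?_)
  simp [Complex.norm_exp, ← Complex.ofReal_pow]

/-- The mean of a Gaussian-dominated density symmetric about `p` is `p`. -/
lemma inv_integral_smul_integral_affine_of_symmetric {g : E → ℝ} (hg : Continuous g)
    (hpos : ∀ y, 0 < g y) {c : ℝ} (hc : 0 < c) {m p : E}
    (hle : ∀ y, g y ≤ Real.exp (-c * ‖y - m‖ ^ 2)) (hsymm : ∀ w, g (p + w) = g (p - w))
    (e : E) (k : ℝ) :
    (∫ y, g y)⁻¹ • ∫ y, g y • (e + k • y) = e + k • p := by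
  have hgi : Integrable g := (integrable_exp_neg_mul_sq_norm_sub hc m).mono'
    hg.aestronglyMeasurable (.of_forall fun y => by
      rw [Real.norm_of_nonneg (hpos y).le]; exact hle y)
  have hZ : 0 < ∫ y, g y := by
    rw [integral_pos_iff_support_of_nonneg (fun y => (hpos y).le) hgi]
    have : Function.support g = univ := by
      ext y; simp [(hpos y).ne']
    rw [this]
    exact isOpen_univ.measure_pos _ univ_nonempty
  have hFi : Integrable fun y => g y • (y - p) := by
    refine ((integrable_exp_neg_mul_sq_norm_sub (half_pos hc) m).const_mul
      (1 + 2 / c + ‖m - p‖)).mono' (by fun_prop) (.of_forall fun y => ?_)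
    rw [norm_smul, Real.norm_of_nonneg (hpos y).le]
    have h1 : ‖y - p‖ ≤ ‖y - m‖ + ‖m - p‖ := norm_sub_le_norm_sub_add_norm_sub y m p
    set r := ‖y - m‖
    have h2 : c / 2 * r ^ 2 + 1 ≤ Real.exp (c / 2 * r ^ 2) := Real.add_one_le_exp _
    have h3 : ‖y - p‖ ≤ (1 + 2 / c + ‖m - p‖) * Real.exp (c / 2 * r ^ 2) := by
      have h4 : (1 + 2 / c + ‖m - p‖) * (c / 2 * r ^ 2 + 1) ≤
          (1 + 2 / c + ‖m - p‖) * Real.exp (c / 2 * r ^ 2) := by gcongr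
      have h5 : (1 + 2 / c + ‖m - p‖) * (c / 2 * r ^ 2 + 1) =
          r ^ 2 + 1 + ‖m - p‖ + (c / 2 * r ^ 2 + 2 / c + ‖m - p‖ * (c / 2 * r ^ 2)) := by
        field_simp; ring
      have h6 : 0 ≤ c / 2 * r ^ 2 + 2 / c + ‖m - p‖ * (c / 2 * r ^ 2) := by positivity
      nlinarith [sq_nonneg (r - 1)]
    calc g y * ‖y - p‖ ≤ Real.exp (-c * r ^ 2) *
          ((1 + 2 / c + ‖m - p‖) * Real.exp (c / 2 * r ^ 2)) := by
          gcongr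
          exact hle y
      _ = (1 + 2 / c + ‖m - p‖) * Real.exp (-(c / 2) * r ^ 2) := by
          rw [mul_left_comm, ← Real.exp_add]
          ring_nf
  have hF0 : ∫ y, g y • (y - p) = 0 := by
    have h := integral_sub_left_eq_self (fun y => g y • (y - p)) volume (p + p)
    have h' : ∀ y, g (p + p - y) • (p + p - y - p) = -(g y • (y - p)) := fun y => by
      rw [show p + p - y = p + (p - y) by abel, hsymm, show p - (p - y) = y by abel,
        show p + (p - y) - p = -(y - p) by abel, smul_neg]
    simp_rw [h', integral_neg] at h
    rw [eq_comm, eq_neg_iff_add_eq_zero, ← two_smul ℝ] at h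
    exact (smul_eq_zero.1 h).resolve_left two_ne_zero
  have hsplit : ∀ y, g y • (e + k • y) = g y • (e + k • p) + k • (g y • (y - p)) := fun y => by
    module
  simp_rw [hsplit]
  have hkF : Integrable fun y => k • (g y • (y - p)) := hFi.smul k
  rw [integral_add (hgi.smul_const _) hkF, integral_smul, hF0, smul_zero, add_zero,
    integral_smul_const, inv_smul_smul₀ hZ.ne']
end

/-- A scalar linear equation `z' = M' / (2 M) z` is solved by multiples of `√M`. -/
lemma eq_sqrt_div_sqrt_mul_of_hasDerivAt {z M M' : ℝ → ℝ} {a b : ℝ} (hab : a < b)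
    (hz : ContinuousOn z (Icc a b)) (hM : ContinuousOn M (Icc a b))
    (hpos : ∀ t ∈ Icc a b, 0 < M t) (hM' : ∀ t ∈ Ioo a b, HasDerivAt M (M' t) t)
    (hz' : ∀ t ∈ Ioo a b, HasDerivAt z (M' t / (2 * M t) * z t) t) :
    z b = √(M b) / √(M a) * z a := by
  have hne : ∀ t ∈ Icc a b, √(M t) ≠ 0 := fun t ht => (Real.sqrt_pos.2 (hpos t ht)).ne'
  obtain ⟨t, ht, h⟩ := exists_hasDerivAt_eq_slope (fun t => z t / √(M t)) (fun _ => 0) hab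
    (hz.div hM.sqrt hne) fun t ht => by
      have hMt := hpos t (Ioo_subset_Icc_self ht)
      have hst := hne t (Ioo_subset_Icc_self ht)
      have h0 : (M' t / (2 * M t) * z t * √(M t) - z t * (M' t / (2 * √(M t)))) / √(M t) ^ 2 =
          0 := by
        have hsq : M t = √(M t) ^ 2 := (Real.sq_sqrt hMt.le).symm
        generalize √(M t) = s at hst hsq
        rw [hsq]
        field_simp
        ring
      rw [← h0]
      exact (hz' t ht).div ((hM' t ht).sqrt hMt.ne') hst
  have h' : z b / √(M b) = z a / √(M a) := by
    rw [eq_comm, div_eq_zero_iff] at h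
    rcases h with h | h <;> linarith
  rw [div_eq_iff (hne b (right_mem_Icc.2 hab.le))] at h'
  rw [h']
  ring

lemma Matrix.PosDef.exists_forall_mul_sq_norm_le_inner {d : ℕ} {S : Matrix (Fin d) (Fin d) ℝ}
    (hS : S.PosDef) :
    ∃ c > 0, ∀ z : Euc d, c * ‖z‖ ^ 2 ≤ ⟪z, Matrix.toEuclideanLin S z⟫ := by
  have hpos : ∀ z : Euc d, z ≠ 0 → 0 < ⟪z, Matrix.toEuclideanLin S z⟫ := fun z hz => by
    have := hS.dotProduct_mulVec_pos (x := z.ofLp) (by simpa using hz)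
    simpa [EuclideanSpace.inner_eq_star_dotProduct, dotProduct_comm] using this
  have hcont : Continuous fun z : Euc d => ⟪z, Matrix.toEuclideanLin S z⟫ :=
    continuous_id.inner (LinearMap.continuous_of_finiteDimensional _)
  rcases (Metric.sphere (0 : Euc d) 1).eq_empty_or_nonempty with h | h
  · refine ⟨1, one_pos, fun z => ?_⟩
    by_cases hz : z = 0
    · simp [hz]
    · have : (‖z‖⁻¹ • z) ∈ Metric.sphere (0 : Euc d) 1 := by
        simp [norm_smul, hz]
      simp [h] at this
  · obtain ⟨u, hu, hmin⟩ := (isCompact_sphere (0 : Euc d) 1).exists_isMinOn h hcont.continuousOn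
    refine ⟨_, hpos u (by rintro rfl; simp at hu), fun z => ?_⟩
    by_cases hz : z = 0
    · simp [hz]
    have hn : ‖z‖ ≠ 0 := norm_ne_zero_iff.2 hz
    have h1 := hmin (show (‖z‖⁻¹ • z) ∈ Metric.sphere (0 : Euc d) 1 by simp [norm_smul, hz])
    simp only [mem_ofPred_eq, map_smul, real_inner_smul_left, real_inner_smul_right] at h1
    calc _ ≤ ‖z‖⁻¹ * (‖z‖⁻¹ * ⟪z, Matrix.toEuclideanLin S z⟫) * ‖z‖ ^ 2 := by gcongr
      _ = _ := by field_simp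

lemma LinearMap.IsSymmetric.inner_add_sub_inner_sub {E : Type*} [NormedAddCommGroup E]
    [InnerProductSpace ℝ E] {P : E →ₗ[ℝ] E} (hP : P.IsSymmetric) (A z : E) :
    ⟪A + z, P (A + z)⟫ - ⟪A - z, P (A - z)⟫ = 4 * ⟪z, P A⟫ := by
  have h : ⟪A, P z⟫ = ⟪z, P A⟫ := by rw [← hP, real_inner_comm]
  simp only [map_add, map_sub, inner_add_left, inner_add_right, inner_sub_left, inner_sub_right, h]
  ring

section

variable {d : ℕ} {m₀ m₁ : Euc d} {S₀ S₁ : Matrix (Fin d) (Fin d) ℝ} {α β : ℝ → ℝ} {t : ℝ}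
  {x p : Euc d}

lemma continuous_gaussPot (m : Euc d) (S : Matrix (Fin d) (Fin d) ℝ) :
    Continuous (gaussPot m S) := by
  have := LinearMap.continuous_of_finiteDimensional (Matrix.toEuclideanLin S⁻¹)
  unfold gaussPot
  fun_prop

lemma condDens_gaussPot_add_eq_sub (hS₀ : S₀.PosDef) (hS₁ : S₁.PosDef)
    (hp : ((α t)⁻¹ * β t) • Matrix.toEuclideanLin S₀⁻¹ ((α t)⁻¹ • (x - β t • p) - m₀) =
      Matrix.toEuclideanLin S₁⁻¹ (p - m₁)) (w : Euc d) :
    condDens (gaussPot m₀ S₀) (gaussPot m₁ S₁) α β t x (p + w) =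
      condDens (gaussPot m₀ S₀) (gaussPot m₁ S₁) α β t x (p - w) := by
  have h0 := (Matrix.isSymmetric_toEuclideanLin_iff.2 hS₀.inv.1).inner_add_sub_inner_sub
    ((α t)⁻¹ • (x - β t • p) - m₀) (((α t)⁻¹ * β t) • w)
  have h1 := (Matrix.isSymmetric_toEuclideanLin_iff.2 hS₁.inv.1).inner_add_sub_inner_sub
    (p - m₁) w
  rw [← hp, real_inner_smul_right] at h1
  rw [real_inner_smul_left] at h0
  unfold condDens gaussPot
  rw [show (α t)⁻¹ • (x - β t • (p + w)) - m₀ =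
      ((α t)⁻¹ • (x - β t • p) - m₀) - ((α t)⁻¹ * β t) • w by module,
    show (α t)⁻¹ • (x - β t • (p - w)) - m₀ =
      ((α t)⁻¹ • (x - β t • p) - m₀) + ((α t)⁻¹ * β t) • w by module,
    show p + w - m₁ = p - m₁ + w by abel, show p - w - m₁ = p - m₁ - w by abel]
  congr 1
  linarith

/-- The conditional expectation of an affine function of `X₁` is its value at the mode `p`. -/
lemma inv_integral_condDens_smul_integral_affine (hS₀ : S₀.PosDef) (hS₁ : S₁.PosDef)
    (hp : ((α t)⁻¹ * β t) • Matrix.toEuclideanLin S₀⁻¹ ((α t)⁻¹ • (x - β t • p) - m₀) =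
      Matrix.toEuclideanLin S₁⁻¹ (p - m₁)) (e : Euc d) (k : ℝ) :
    (∫ y : Euc d, condDens (gaussPot m₀ S₀) (gaussPot m₁ S₁) α β t x y)⁻¹ •
        ∫ y : Euc d, condDens (gaussPot m₀ S₀) (gaussPot m₁ S₁) α β t x y • (e + k • y) =
      e + k • p := by
  obtain ⟨c₀, hc₀, h₀⟩ := hS₀.inv.exists_forall_mul_sq_norm_le_inner
  obtain ⟨c, hc, h₁⟩ := hS₁.inv.exists_forall_mul_sq_norm_le_inner
  refine inv_integral_smul_integral_affine_of_symmetric (m := m₁) ?_ ?_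
    (half_pos hc) (fun y => ?_) (condDens_gaussPot_add_eq_sub hS₀ hS₁ hp) e k
  · have h0 := continuous_gaussPot m₀ S₀
    have h1 := continuous_gaussPot m₁ S₁
    unfold condDens
    fun_prop
  · exact fun y => Real.exp_pos _
  · refine Real.exp_le_exp.2 ?_
    have h0 := (by positivity : (0 : ℝ) ≤ _).trans (h₀ ((α t)⁻¹ • (x - β t • y) - m₀))
    have h1 := h₁ (y - m₁)
    unfold gaussPot
    linarith

lemma toEuclideanLin_apply_inv_apply {S : Matrix (Fin d) (Fin d) ℝ} (hS : IsUnit S) (w : Euc d) :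
    Matrix.toEuclideanLin S (Matrix.toEuclideanLin S⁻¹ w) = w := by
  rw [← LinearMap.comp_apply, ← Matrix.toLpLin_mul,
    Matrix.mul_nonsing_inv _ ((Matrix.isUnit_iff_isUnit_det _).1 hS), Matrix.toLpLin_one]
  rfl

lemma exists_condDens_mode (hS₀ : S₀.PosDef) (hS₁ : S₁.PosDef) (hα : 0 < α t) (hβ : 0 < β t)
    (m₀ m₁ x : Euc d) :
    ∃ p : Euc d, ((α t)⁻¹ * β t) • Matrix.toEuclideanLin S₀⁻¹ ((α t)⁻¹ • (x - β t • p) - m₀) =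
      Matrix.toEuclideanLin S₁⁻¹ (p - m₁) := by
  have hK : (((α t)⁻¹ * β t) ^ 2 • S₀⁻¹ + S₁⁻¹).PosDef :=
    (hS₀.inv.smul (by positivity)).add hS₁.inv
  set K := ((α t)⁻¹ * β t) ^ 2 • S₀⁻¹ + S₁⁻¹ with hKdef
  set w : Euc d := ((α t)⁻¹ * β t) • Matrix.toEuclideanLin S₀⁻¹ ((α t)⁻¹ • x - m₀) +
    Matrix.toEuclideanLin S₁⁻¹ m₁ with hw
  refine ⟨Matrix.toEuclideanLin K⁻¹ w, ?_⟩
  have h : Matrix.toEuclideanLin K (Matrix.toEuclideanLin K⁻¹ w) = w :=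
    toEuclideanLin_apply_inv_apply hK.isUnit w
  set p := Matrix.toEuclideanLin K⁻¹ w
  rw [hKdef, hw, map_add, map_smul, LinearMap.add_apply, LinearMap.smul_apply] at h
  simp only [map_sub, map_smul, smul_sub] at h ⊢
  linear_combination (norm := module) (-1 : ℝ) • h

/-- Pairing with an eigenvector diagonalizes the inverse of a symmetric matrix. -/
lemma inner_toEuclideanLin_inv_of_eigenvector {S : Matrix (Fin d) (Fin d) ℝ} (hS : S.IsHermitian)
    (hu : IsUnit S) {u : Euc d} {a : ℝ} (ha : a ≠ 0) (h : Matrix.toEuclideanLin S u = a • u)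
    (w : Euc d) : ⟪u, Matrix.toEuclideanLin S⁻¹ w⟫ = a⁻¹ * ⟪u, w⟫ := by
  conv_rhs => rw [← toEuclideanLin_apply_inv_apply hu w,
    ← Matrix.isSymmetric_toEuclideanLin_iff.2 hS, h, real_inner_smul_left]
  rw [inv_mul_cancel_left₀ ha]

/-- Along a joint eigenvector of the covariances the velocity is an affine function of `x`. -/
lemma inner_velocity_of_joint_eigenvector {u V : Euc d} {a b : ℝ} (hS₀ : S₀.PosDef)
    (hS₁ : S₁.PosDef) (hα : 0 < α t) (hβ : 0 < β t) (ha : 0 < a) (hb : 0 < b)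
    (hu₀ : Matrix.toEuclideanLin S₀ u = a • u) (hu₁ : Matrix.toEuclideanLin S₁ u = b • u)
    (hV : V = (∫ y : Euc d, condDens (gaussPot m₀ S₀) (gaussPot m₁ S₁) α β t x y)⁻¹ •
        ∫ y : Euc d, condDens (gaussPot m₀ S₀) (gaussPot m₁ S₁) α β t x y •
          ((deriv α t / α t) • (x - β t • y) + deriv β t • y)) :
    ⟪u, V⟫ - deriv α t * ⟪u, m₀⟫ - deriv β t * ⟪u, m₁⟫ =
      (2 * α t * deriv α t * a + 2 * β t * deriv β t * b) / (2 * (α t ^ 2 * a + β t ^ 2 * b)) *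
        (⟪u, x⟫ - α t * ⟪u, m₀⟫ - β t * ⟪u, m₁⟫) := by
  obtain ⟨p, hp⟩ := exists_condDens_mode hS₀ hS₁ hα hβ m₀ m₁ x
  have hform : ∀ y : Euc d, (deriv α t / α t) • (x - β t • y) + deriv β t • y =
      (deriv α t / α t) • x + (deriv β t - deriv α t / α t * β t) • y := fun y => by module
  simp_rw [hform] at hV
  rw [inv_integral_condDens_smul_integral_affine hS₀ hS₁ hp] at hV
  have hq := congrArg (fun z => ⟪u, z⟫) hp
  simp only [real_inner_smul_right, inner_sub_right,
    inner_toEuclideanLin_inv_of_eigenvector hS₀.1 hS₀.isUnit ha.ne' hu₀,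
    inner_toEuclideanLin_inv_of_eigenvector hS₁.1 hS₁.isUnit hb.ne' hu₁] at hq
  rw [hV]
  simp only [inner_add_right, real_inner_smul_right]
  have hD : 0 < α t ^ 2 * a + β t ^ 2 * b := by positivity
  have hP : ⟪u, p⟫ = (β t * b * (⟪u, x⟫ - α t * ⟪u, m₀⟫) + α t ^ 2 * a * ⟪u, m₁⟫) /
      (α t ^ 2 * a + β t ^ 2 * b) := by
    rw [eq_div_iff hD.ne']
    field_simp at hq
    linear_combination -hq
  rw [hP]
  field_simp
  ring

lemma Matrix.PosDef.pos_of_eigenvector {S : Matrix (Fin d) (Fin d) ℝ} (hS : S.PosDef) {u : Euc d}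
    (hu : u ≠ 0) {a : ℝ} (h : Matrix.toEuclideanLin S u = a • u) : 0 < a := by
  obtain ⟨c, hc, hle⟩ := hS.exists_forall_mul_sq_norm_le_inner
  have h1 := hle u
  rw [h, real_inner_smul_right, real_inner_self_eq_norm_sq] at h1
  have h2 : 0 < ‖u‖ ^ 2 := by positivity
  exact hc.trans_le (le_of_mul_le_mul_right h1 h2)

lemma toEuclideanLin_sqrt_apply_eigenvector {S R : Matrix (Fin d) (Fin d) ℝ}
    (hR : R.PosSemidef) (hRS : R * R = S) {u : Euc d} {a : ℝ} (ha : 0 < a)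
    (h : Matrix.toEuclideanLin S u = a • u) : Matrix.toEuclideanLin R u = √a • u := by
  refine (Matrix.isPositive_toEuclideanLin_iff.2 hR).apply_eq_sqrt_smul ha ?_
  rw [← h, ← hRS, Matrix.toLpLin_mul (q := 2)]
  rfl

end


/-- For Gaussian endpoints `μ₀ = N(m₀, S₀)`, `μ₁ = N(m₁, S₁)` with
commuting positive definite covariances, the time-one flow map of the isotropic stochastic
interpolant (for any coefficients) equals the quadratic-cost optimal transport map
`T(x) = m₁ + S₁^{1/2} S₀^{-1/2}(x − m₀)`. (The matrix square roots are specified as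
arbitrary positive semidefinite square roots, which are unique.) -/
theorem gaussian_interpolant_time_one_is_optimal_transport
    (d : ℕ) (m₀ m₁ : Euc d) (S₀ S₁ : Matrix (Fin d) (Fin d) ℝ)
    (hS₀ : S₀.PosDef) (hS₁ : S₁.PosDef) (hcomm : S₀ * S₁ = S₁ * S₀)
    (α β : ℝ → ℝ) (hα : ContDiff ℝ 2 α) (hβ : ContDiff ℝ 2 β)
    (hα0 : α 0 = 1) (hα1 : α 1 = 0) (hβ0 : β 0 = 0) (hβ1 : β 1 = 1)
    (hαpos : ∀ t ∈ Ioo (0:ℝ) 1, 0 < α t) (hβpos : ∀ t ∈ Ioo (0:ℝ) 1, 0 < β t)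
    (v : ℝ → Euc d → Euc d)
    -- `v t x = E[α̇_t X₀ + β̇_t X₁ | X_t = x]`, realized via the regular conditional density:
    (hv : ∀ t ∈ Ioo (0:ℝ) 1, ∀ x : Euc d, v t x =
      (∫ y : Euc d, condDens (gaussPot m₀ S₀) (gaussPot m₁ S₁) α β t x y)⁻¹ •
        ∫ y : Euc d, condDens (gaussPot m₀ S₀) (gaussPot m₁ S₁) α β t x y •
          ((deriv α t / α t) • (x - β t • y) + deriv β t • y))
    (f : ℝ → Euc d → Euc d)
    (hf0 : ∀ x : Euc d, f 0 x = x)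
    (hfc : ∀ x : Euc d, ContinuousOn (fun s => f s x) (Icc (0:ℝ) 1))
    (hflow : ∀ x : Euc d, ∀ t ∈ Ioo (0:ℝ) 1, HasDerivAt (fun s => f s x) (v t (f t x)) t) :
    ∀ x : Euc d, ∀ S₁r S₀r : Matrix (Fin d) (Fin d) ℝ,
      S₁r.PosSemidef → S₁r * S₁r = S₁ →
      S₀r.PosSemidef → S₀r * S₀r = S₀ →
      f 1 x = m₁ + Matrix.toEuclideanLin (S₁r * S₀r⁻¹) (x - m₀) := by
  intro x S₁r S₀r hS₁r hS₁r_sq hS₀r hS₀r_sq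
  have hcommute : Commute (Matrix.toEuclideanLin S₀) (Matrix.toEuclideanLin S₁) := by
    have h := congrArg Matrix.toEuclideanLin hcomm
    rwa [Matrix.toLpLin_mul (q := 2), Matrix.toLpLin_mul (q := 2)] at h
  refine eq_of_inner_joint_eigenvectors_eq (Matrix.isSymmetric_toEuclideanLin_iff.2 hS₀.1)
    (Matrix.isSymmetric_toEuclideanLin_iff.2 hS₁.1) hcommute fun u a b hu₀ hu₁ => ?_
  by_cases hu : u = 0
  · simp [hu]
  have ha := hS₀.pos_of_eigenvector hu hu₀
  have hb := hS₁.pos_of_eigenvector hu hu₁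
  have hdα : ∀ t, HasDerivAt α (deriv α t) t := fun t =>
    (hα.differentiable two_ne_zero t).hasDerivAt
  have hdβ : ∀ t, HasDerivAt β (deriv β t) t := fun t =>
    (hβ.differentiable two_ne_zero t).hasDerivAt
  have hcα := hα.continuous
  have hcβ := hβ.continuous
  have hfx := hfc x
  have hsol := eq_sqrt_div_sqrt_mul_of_hasDerivAt
    (z := fun t => ⟪u, f t x⟫ - α t * ⟪u, m₀⟫ - β t * ⟪u, m₁⟫)
    (M := fun t => α t ^ 2 * a + β t ^ 2 * b)
    (M' := fun t => 2 * α t * deriv α t * a + 2 * β t * deriv β t * b) zero_lt_one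
    (((continuousOn_const.inner hfx).sub (by fun_prop)).sub (by fun_prop)) (by fun_prop)
    (fun t ht => by
      rcases ht.1.eq_or_lt with rfl | h0
      · simpa [hα0, hβ0] using ha
      rcases ht.2.eq_or_lt with rfl | h1
      · simpa [hα1, hβ1] using hb
      have := hαpos t ⟨h0, h1⟩
      positivity)
    (fun t _ => ((((hdα t).pow 2).mul_const a).add (((hdβ t).pow 2).mul_const b)).congr_deriv
        (by norm_num))
    (fun t ht => by
      rw [← inner_velocity_of_joint_eigenvector hS₀ hS₁ (hαpos t ht) (hβpos t ht) ha hb hu₀ hu₁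
        (hv t ht (f t x))]
      have hin : HasDerivAt (fun s => ⟪u, f s x⟫) ⟪u, v t (f t x)⟫ t := by
        simpa using (hasDerivAt_const t u).inner ℝ (hflow x t ht)
      exact (hin.sub ((hdα t).mul_const _)).sub ((hdβ t).mul_const _))
  simp only [hα0, hα1, hβ0, hβ1, hf0] at hsol
  have hS₀r_unit : IsUnit S₀r := by
    have h := hS₀.isUnit
    rw [← hS₀r_sq] at h
    exact isUnit_of_mul_isUnit_left h
  have hmap : ⟪u, Matrix.toEuclideanLin (S₁r * S₀r⁻¹) (x - m₀)⟫ =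
      √b * ((√a)⁻¹ * ⟪u, x - m₀⟫) := by
    rw [Matrix.toLpLin_mul (q := 2), LinearMap.comp_apply,
      ← Matrix.isSymmetric_toEuclideanLin_iff.2 hS₁r.1,
      toEuclideanLin_sqrt_apply_eigenvector hS₁r hS₁r_sq hb hu₁, real_inner_smul_left,
      inner_toEuclideanLin_inv_of_eigenvector hS₀r.1 hS₀r_unit (Real.sqrt_pos.2 ha).ne'
        (toEuclideanLin_sqrt_apply_eigenvector hS₀r hS₀r_sq ha hu₀)]
  rw [inner_add_right, hmap, inner_sub_right]
  norm_num at hsol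
  rw [sub_eq_iff_eq_add] at hsol
  rw [hsol]
  ring
end
end
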